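/- arXiv:2412.06524 — 5 statements merged into one kernel-verified Lean document; each statement's English description precedes it below -/
import Mathlib

section
/- Fix integers 2 ≤ k < n and a permutation σ ∈ S_n with cycle sets C_1,…,C_r of sizes s_1,…,s_r, and let g = gcd(s_1,…,s_r,k). Let τ ∈ ℤ/kℤ satisfy g·τ = 0, let 1 ≤ h ≤ k−1, and let J be a set of h pairwise disjoint elements of Λ. Put j = |⋃_{u∈J} ind(u)| and i = |⋃_{u∈J} u|, and assume i ≤ k−1 (note that the order o(τ) of τ divides k−i, since o(τ) divides g). Then |⋂_{u∈J} 𝓓^τ_u| = ( ((k−i)/o(τ) + h − 1)! / ((k−i)/o(τ))! ) · o(τ)^{j−1} · (k−i)^{r−j}. -/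
open Finset

/-- The set of cycle sets (orbits, counting fixed points as 1-cycles) of a permutation. -/
def cycleSets {n : ℕ} (σ : Equiv.Perm (Fin n)) : Finset (Finset (Fin n)) :=
  Finset.image (fun x => Finset.univ.filter fun y => σ.SameCycle x y) Finset.univ

/-- Functions [n] → ℤ/kℤ up to additive constants: (k,n)-DOSPs. -/
def dospSetoid (n k : ℕ) : Setoid (Fin n → ZMod k) where
  r f g := ∃ c : ZMod k, ∀ i, f i = g i + c
  iseqv := by
    refine ⟨fun f => ⟨0, fun i => by simp⟩, ?_, ?_⟩
    · rintro f g ⟨c, hc⟩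
      exact ⟨-c, fun i => by rw [hc i]; ring⟩
    · rintro f g h ⟨c, hc⟩ ⟨d, hd⟩
      exact ⟨d + c, fun i => by rw [hc i, hd i]; ring⟩

/-- ℓ(c): the least ℓ with 1 ≤ ℓ ≤ k such that c + ℓ is occupied for f. -/
noncomputable def gapLen {n k : ℕ} (f : Fin n → ZMod k) (c : ZMod k) : ℕ :=
  sInf {ℓ : ℕ | 1 ≤ ℓ ∧ ℓ ≤ k ∧ ∃ i, f i = c + (ℓ : ZMod k)}

/-- A function represents a hypersimplicial DOSP if every occupied value c has more
    than ℓ(c) preimages. -/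
def Hypersimplicial {n k : ℕ} (f : Fin n → ZMod k) : Prop :=
  ∀ c : ZMod k, (∃ i, f i = c) →
    gapLen f c < (Finset.univ.filter fun i => f i = c).card

/-- f has an occupied value c whose fiber L = f⁻¹(c) is a bad set (|L| ≤ ℓ(c)) which
    lies in u and meets every cycle set C a contained in u. -/
def BadFor {n k r : ℕ} (C : Fin r → Finset (Fin n)) (f : Fin n → ZMod k)
    (u : Finset (Fin n)) : Prop :=
  ∃ c : ZMod k, (∃ i, f i = c) ∧
    (Finset.univ.filter fun i => f i = c).card ≤ gapLen f c ∧
    (Finset.univ.filter fun i => f i = c) ⊆ u ∧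
    ∀ a : Fin r, C a ⊆ u → ((Finset.univ.filter fun i => f i = c) ∩ C a).Nonempty


section arcs
variable {ι : Type*} [Fintype ι] [DecidableEq ι]

/-- total excess weight of the arcs starting before `b` -/
def exc (w P : ι → ℕ) (b : ℕ) : ℕ := ∑ v with P v < b, (w v - 1)

lemma exc_split (w P : ι → ℕ) {a b : ℕ} (hab : a ≤ b) :
    exc w P b = exc w P a + ∑ v with a ≤ P v ∧ P v < b, (w v - 1) := by
  unfold exc
  rw [← Finset.sum_union]
  · congr 1; ext v; simp; omega
  · rw [Finset.disjoint_left]; intro v; simp; omega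

lemma arcs_sum_le (w P : ι → ℕ) (hP : ∀ i j, i ≠ j → P i ≤ P j → P i + w i ≤ P j)
    (a b : ℕ) (hb : ∀ v, P v < b → P v + w v ≤ b) :
    ∑ v with a ≤ P v ∧ P v < b, w v ≤ b - a := by
  have h1 : ((univ.filter fun v => a ≤ P v ∧ P v < b).biUnion
      fun v => Finset.Ico (P v) (P v + w v)) ⊆ Finset.Ico a b := by
    intro x; simp only [mem_biUnion, mem_filter, mem_univ, true_and, mem_Ico]
    rintro ⟨v, ⟨h1, h2⟩, h3, h4⟩
    have := hb v h2
    omega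
  have h2 := Finset.card_le_card h1
  rw [Finset.card_biUnion] at h2
  · simpa using h2
  · intro i _ j _ hij
    change Disjoint _ _
    rw [Finset.disjoint_left]; intro x; simp only [mem_Ico]
    intro hx hx'
    rcases le_total (P i) (P j) with h | h
    · have := hP i j hij h; omega
    · have := hP j i hij.symm h; omega

lemma sum_exc (w : ι → ℕ) (hw : ∀ i, 0 < w i) (s : Finset ι) :
    ∑ v ∈ s, (w v - 1) + s.card = ∑ v ∈ s, w v := by
  rw [Finset.card_eq_sum_ones, ← Finset.sum_add_distrib]
  exact Finset.sum_congr rfl fun v _ => Nat.sub_add_cancel (hw v)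

lemma rank_lt (w P : ι → ℕ) (hw : ∀ i, 0 < w i)
    (hP : ∀ i j, i ≠ j → P i ≤ P j → P i + w i ≤ P j)
    (i : ι) (b : ℕ) (hib : P i < b) (hb : ∀ v, P v < b → P v + w v ≤ b) :
    P i + exc w P b + 1 ≤ b + exc w P (P i) := by
  rw [exc_split w P hib.le]
  have h1 := arcs_sum_le w P hP (P i) b hb
  have h2 := sum_exc w hw (univ.filter fun v => P i ≤ P v ∧ P v < b)
  have h3 : 0 < (univ.filter fun v => P i ≤ P v ∧ P v < b).card :=
    Finset.card_pos.mpr ⟨i, by simp [hib]⟩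
  omega

lemma exc_le (w P : ι → ℕ) (hw : ∀ i, 0 < w i)
    (hP : ∀ i j, i ≠ j → P i ≤ P j → P i + w i ≤ P j) (i : ι) :
    exc w P (P i) ≤ P i := by
  rw [exc_split w P (Nat.zero_le _)]
  have h1 := arcs_sum_le w P hP 0 (P i) (fun v hv => hP v i (by rintro rfl; omega) hv.le)
  have h2 := sum_exc w hw (univ.filter fun v => 0 ≤ P v ∧ P v < P i)
  have : exc w P 0 = 0 := by simp [exc]
  omega

lemma exc_full (w P : ι → ℕ) (hw : ∀ i, 0 < w i) (b : ℕ) (hb : ∀ v, P v < b) :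
    exc w P b + Fintype.card ι = ∑ v, w v := by
  have : (univ.filter fun v => P v < b) = univ := by ext v; simp [hb]
  rw [exc, this, ← sum_exc w hw univ, Finset.card_univ]

def rk (w P : ι → ℕ) (i : ι) : ℕ := P i - exc w P (P i)
def urk (w e : ι → ℕ) (i : ι) : ℕ := e i + exc w e (e i)

lemma rk_lt_rk (w P : ι → ℕ) (hw : ∀ i, 0 < w i)
    (hP : ∀ i j, i ≠ j → P i ≤ P j → P i + w i ≤ P j) {i j : ι} (h : P i < P j) :
    rk w P i < rk w P j := by
  have h1 := rank_lt w P hw hP i (P j) h (fun v hv => hP v j (by rintro rfl; omega) hv.le)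
  have h2 := exc_le w P hw hP i
  have h3 := exc_le w P hw hP j
  unfold rk; omega

lemma P_inj (w P : ι → ℕ) (hw : ∀ i, 0 < w i)
    (hP : ∀ i j, i ≠ j → P i ≤ P j → P i + w i ≤ P j) {i j : ι} (h : P i = P j) : i = j := by
  by_contra hne
  have := hP i j hne h.le
  have := hw i
  omega

lemma rk_lt_iff (w P : ι → ℕ) (hw : ∀ i, 0 < w i)
    (hP : ∀ i j, i ≠ j → P i ≤ P j → P i + w i ≤ P j) {i j : ι} :
    rk w P i < rk w P j ↔ P i < P j := by
  refine ⟨fun h => ?_, rk_lt_rk w P hw hP⟩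
  by_contra hc
  rcases Nat.lt_or_ge (P j) (P i) with h' | h'
  · have := rk_lt_rk w P hw hP h'; omega
  · have := P_inj w P hw hP (le_antisymm h' (not_lt.mp hc)); subst this; omega

lemma urk_add_le (w e : ι → ℕ) (hw : ∀ i, 0 < w i) (i : ι) (b : ℕ) (h : e i < b) :
    urk w e i + w i ≤ b + exc w e b := by
  rw [exc_split w e h.le]
  have : w i - 1 ≤ ∑ v with e i ≤ e v ∧ e v < b, (w v - 1) :=
    Finset.single_le_sum (f := fun v => w v - 1) (fun _ _ => Nat.zero_le _) (by simp [h])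
  have := hw i
  unfold urk; omega

lemma urk_lt_iff (w e : ι → ℕ) (hw : ∀ i, 0 < w i) {i j : ι} :
    urk w e i < urk w e j ↔ e i < e j := by
  have key : ∀ i j, e i < e j → urk w e i < urk w e j := fun i j h => by
    have := urk_add_le w e hw i (e j) h
    have := hw i
    change urk w e i < e j + exc w e (e j)
    omega
  refine ⟨fun h => ?_, key i j⟩
  by_contra hc
  rcases Nat.lt_or_ge (e j) (e i) with h' | h'
  · have := key _ _ h'; omega
  · have h2 : e i = e j := le_antisymm h' (not_lt.mp hc)
    unfold urk at h; rw [h2] at h; omega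

lemma urk_rk (w P : ι → ℕ) (hw : ∀ i, 0 < w i)
    (hP : ∀ i j, i ≠ j → P i ≤ P j → P i + w i ≤ P j) : urk w (rk w P) = P := by
  funext i
  have : exc w (rk w P) (rk w P i) = exc w P (P i) := by
    unfold exc; congr 1; ext v; simp [rk_lt_iff w P hw hP]
  have h2 := exc_le w P hw hP i
  rw [urk, this, rk]; omega

lemma rk_urk (w e : ι → ℕ) (hw : ∀ i, 0 < w i) : rk w (urk w e) = e := by
  funext i
  have : exc w (urk w e) (urk w e i) = exc w e (e i) := by
    unfold exc; congr 1; ext v; simp [urk_lt_iff w e hw]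
  rw [rk, this, urk]; omega

lemma card_inj_fixed (i0 : ι) (M : ℕ) (z : Fin (M+1)) :
    (univ.filter fun e : ι → Fin (M+1) => Function.Injective e ∧ e i0 = z).card =
      M.descFactorial (Fintype.card ι - 1) := by
  have htot : (univ.filter fun e : ι → Fin (M+1) => Function.Injective e).card =
      (M+1).descFactorial (Fintype.card ι) := by
    rw [← Fintype.card_subtype, Fintype.card_congr (Equiv.subtypeInjectiveEquivEmbedding _ _),
      Fintype.card_embedding_eq, Fintype.card_fin]
  have hfib := Finset.card_eq_sum_card_fiberwise
    (s := univ.filter fun e : ι → Fin (M+1) => Function.Injective e) (t := univ)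
    (f := fun e => e i0) (fun _ _ => by simp)
  have hsame : ∀ x : Fin (M+1),
      ((univ.filter fun e : ι → Fin (M+1) => Function.Injective e).filter fun e => e i0 = x).card
      = (univ.filter fun e : ι → Fin (M+1) => Function.Injective e ∧ e i0 = z).card := by
    intro x
    refine Finset.card_nbij' (fun e => Equiv.swap x z ∘ e) (fun e => Equiv.swap x z ∘ e) ?_ ?_ ?_ ?_
    · intro e; simp only [coe_filter, mem_filter, mem_univ, true_and, Set.mem_ofPred_eq]
      rintro ⟨h1, h2⟩
      exact ⟨(Equiv.injective _).comp h1, by simp [h2]⟩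
    · intro e; simp only [coe_filter, mem_filter, mem_univ, true_and, Set.mem_ofPred_eq]
      rintro ⟨h1, h2⟩
      exact ⟨(Equiv.injective _).comp h1, by simp [h2]⟩
    · intro e _; funext i; simp
    · intro e _; funext i; simp
  rw [htot, Finset.sum_congr rfl (fun x _ => hsame x)] at hfib
  have hpos : 0 < Fintype.card ι := Fintype.card_pos_iff.mpr ⟨i0⟩
  obtain ⟨c, hc⟩ := Nat.exists_eq_succ_of_ne_zero hpos.ne'
  rw [hc, Nat.succ_descFactorial_succ] at hfib
  simp only [sum_const, card_univ, Fintype.card_fin, smul_eq_mul] at hfib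
  rw [hc]
  exact (Nat.eq_of_mul_eq_mul_left (Nat.succ_pos M) hfib).symm

lemma card_placements (m : ℕ) [NeZero m] (w : ι → ℕ) (hw : ∀ i, 0 < w i) (i0 : ι) (N : ℕ)
    (hm : m = N + ∑ v, w v) :
    (univ.filter fun Q : ι → ZMod m => Q i0 = 0 ∧
      ∀ i j, i ≠ j → ∀ t < w i, Q j ≠ Q i + (t : ZMod m)).card =
      (N + Fintype.card ι - 1).descFactorial (Fintype.card ι - 1) := by
  have hpos : 0 < Fintype.card ι := Fintype.card_pos_iff.mpr ⟨i0⟩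
  obtain ⟨M, hM⟩ : ∃ M, N + Fintype.card ι = M + 1 := ⟨N + Fintype.card ι - 1, by omega⟩
  have hM' : N + Fintype.card ι - 1 = M := by omega
  rw [hM', ← card_inj_fixed i0 M 0]
  have hwm : ∀ i, w i ≤ m := fun i => by
    have := Finset.single_le_sum (f := w) (fun _ _ => Nat.zero_le _) (mem_univ i)
    omega
  -- the linear form of the placement conditions
  have lin : ∀ Q : ι → ZMod m, (Q i0 = 0 ∧
      ∀ i j, i ≠ j → ∀ t < w i, Q j ≠ Q i + (t : ZMod m)) →
      (∀ i, (Q i).val + w i ≤ m) ∧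
      (∀ i j, i ≠ j → (Q i).val ≤ (Q j).val → (Q i).val + w i ≤ (Q j).val) := by
    rintro Q ⟨h0, hQ⟩
    constructor
    · intro i
      by_contra hc
      have hlt := ZMod.val_lt (Q i)
      by_cases hi : i = i0
      · subst hi; rw [h0] at hc; have := hwm i; simp at hc; omega
      · refine hQ i i0 hi (m - (Q i).val) (by omega) ?_
        rw [h0, Nat.cast_sub hlt.le]; simp
    · intro i j hij hle
      by_contra hc
      refine hQ i j hij ((Q j).val - (Q i).val) (by omega) ?_
      rw [Nat.cast_sub hle]; simp
  have rkb : ∀ Q : ι → ZMod m, (Q i0 = 0 ∧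
      ∀ i j, i ≠ j → ∀ t < w i, Q j ≠ Q i + (t : ZMod m)) →
      ∀ i, rk w (fun v => (Q v).val) i < M + 1 := by
    intro Q hQ i
    obtain ⟨h1, h2⟩ := lin Q hQ
    have h3 := rank_lt w (fun v => (Q v).val) hw h2 i m (ZMod.val_lt _) (fun v _ => h1 v)
    have h4 := exc_full w (fun v => (Q v).val) hw m (fun v => ZMod.val_lt _)
    have h5 := exc_le w (fun v => (Q v).val) hw h2 i
    unfold rk
    simp only at *
    omega
  have urb : ∀ e : ι → Fin (M+1), ∀ i, urk w (fun v => (e v).val) i + w i ≤ m := by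
    intro e i
    have h3 := urk_add_le w (fun v => (e v).val) hw i (M+1) (e i).2
    have h4 := exc_full w (fun v => (e v).val) hw (M+1) (fun v => (e v).2)
    omega
  have urv : ∀ e : ι → Fin (M+1), ∀ i,
      ((urk w (fun v => (e v).val) i : ℕ) : ZMod m).val = urk w (fun v => (e v).val) i := by
    intro e i
    apply ZMod.val_cast_of_lt
    have := urb e i; have := hw i; omega
  refine Finset.card_nbij' (fun Q i => Fin.ofNat (M+1) (rk w (fun v => (Q v).val) i))
    (fun e i => ((urk w (fun v => (e v).val) i : ℕ) : ZMod m)) ?_ ?_ ?_ ?_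
  · intro Q hQ
    simp only [coe_filter, mem_univ, true_and, Set.mem_ofPred_eq] at hQ ⊢
    obtain ⟨h1, h2⟩ := lin Q hQ
    constructor
    · intro i j hij
      have := congrArg Fin.val hij
      simp only [Fin.ofNat, Nat.mod_eq_of_lt (rkb Q hQ _)] at this
      by_contra hne
      rcases lt_trichotomy (Q i).val (Q j).val with h | h | h
      · have := rk_lt_rk w (fun v => (Q v).val) hw h2 (i := i) (j := j) h; omega
      · exact hne (P_inj w (fun v => (Q v).val) hw h2 h)
      · have := rk_lt_rk w (fun v => (Q v).val) hw h2 (i := j) (j := i) h; omega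
    · ext
      simp [Fin.ofNat, rk, hQ.1]
  · intro e he
    simp only [coe_filter, mem_univ, true_and, Set.mem_ofPred_eq] at he ⊢
    constructor
    · have : exc w (fun v => (e v).val) 0 = 0 := by simp [exc]
      simp [urk, he.2, this]
    · intro i j hij t ht heq
      have hne : (e i).val ≠ (e j).val := fun h => hij (he.1 (Fin.ext h))
      have hb := urb e i
      have h1 := congrArg ZMod.val heq
      rw [← Nat.cast_add, urv, ZMod.val_cast_of_lt (by omega)] at h1
      rcases lt_or_gt_of_ne hne with h | h
      · have h3 := urk_add_le w (fun v => (e v).val) hw i (e j).val h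
        change _ ≤ urk w (fun v => (e v).val) j at h3
        omega
      · have h3 := (urk_lt_iff w (fun v => (e v).val) hw (i := j) (j := i)).mpr h
        omega
  · intro Q hQ
    simp only [coe_filter, mem_univ, true_and, Set.mem_ofPred_eq] at hQ
    obtain ⟨h1, h2⟩ := lin Q hQ
    funext i
    have : (fun v => (Fin.ofNat (M+1) (rk w (fun v => (Q v).val) v)).val)
        = rk w (fun v => (Q v).val) := by
      funext v; simp only [Fin.ofNat, Nat.mod_eq_of_lt (rkb Q hQ _)]
    simp only [this, urk_rk w (fun v => (Q v).val) hw h2]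
    simp
  · intro e he
    funext i
    have : (fun v => ((urk w (fun v => (e v).val) v : ℕ) : ZMod m).val)
        = urk w (fun v => (e v).val) := by
      funext v; exact urv e v
    ext
    simp only [this, rk_urk w _ hw, Fin.ofNat, Nat.mod_eq_of_lt (e i).2]

end arcs
section valid

lemma card_fib {k m o : ℕ} [NeZero m] [NeZero k] (hmk : m ∣ k) (hk : k = m * o) (c : ZMod m) :
    (univ.filter fun y : ZMod k => ZMod.castHom hmk (ZMod m) y = c).card = o := by
  have hsurj : Function.Surjective (ZMod.castHom hmk (ZMod m)) := ZMod.castHom_surjective hmk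
  have hfib := Finset.card_eq_sum_card_fiberwise
    (s := (univ : Finset (ZMod k))) (t := (univ : Finset (ZMod m)))
    (f := ZMod.castHom hmk (ZMod m)) (fun _ _ => by simp)
  have hsame : ∀ x : ZMod m, (univ.filter fun y : ZMod k => ZMod.castHom hmk (ZMod m) y = x).card
      = (univ.filter fun y : ZMod k => ZMod.castHom hmk (ZMod m) y = c).card := by
    intro x
    exact AddMonoidHom.card_fiber_eq_of_mem_range (ZMod.castHom hmk (ZMod m)).toAddMonoidHom
      (hsurj x) (hsurj c)
  rw [Finset.sum_congr rfl (fun x _ => hsame x)] at hfib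
  simp only [sum_const, card_univ, ZMod.card, smul_eq_mul] at hfib
  rw [← Nat.mul_left_cancel_iff (Nat.pos_of_ne_zero (NeZero.ne m)), ← hfib, hk]

lemma card_preim {k m o : ℕ} [NeZero m] [NeZero k] (hmk : m ∣ k) (hk : k = m * o)
    (F : Finset (ZMod m)) :
    (univ.filter fun y : ZMod k => ZMod.castHom hmk (ZMod m) y ∈ F).card = o * F.card := by
  rw [Finset.card_eq_sum_card_fiberwise (t := F) (f := ZMod.castHom hmk (ZMod m))
    (fun y hy => by simpa only [coe_filter, mem_univ, true_and, Set.mem_ofPred_eq, mem_coe] using hy)]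
  rw [Finset.sum_congr rfl (g := fun _ => o)]
  · simp [mul_comm]
  · intro x hx
    rw [← card_fib hmk hk x]
    congr 1; ext y; simp only [mem_filter, mem_univ, true_and]
    constructor
    · exact fun h => h.2
    · rintro rfl; exact ⟨hx, rfl⟩

lemma card_free {ι : Type*} [Fintype ι] [DecidableEq ι] (m : ℕ) [NeZero m] (w : ι → ℕ) (N : ℕ)
    (hm : m = N + ∑ v, w v) (Q : ι → ZMod m)
    (hQ : ∀ i j, i ≠ j → ∀ t < w i, Q j ≠ Q i + (t : ZMod m)) :
    (univ.filter fun z : ZMod m => ∀ i, ∀ t < w i, z ≠ Q i + (t : ZMod m)).card = N := by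
  have hwm : ∀ i, w i ≤ m := fun i => by
    have := Finset.single_le_sum (f := w) (fun _ _ => Nat.zero_le _) (mem_univ i)
    omega
  have h1 : (univ.filter fun z : ZMod m => ∀ i, ∀ t < w i, z ≠ Q i + (t : ZMod m)) =
      (univ.biUnion fun i => (range (w i)).image fun t : ℕ => Q i + (t : ZMod m))ᶜ := by
    ext z
    simp only [mem_filter, mem_univ, true_and, mem_compl, mem_biUnion, mem_image, mem_range,
      not_exists, not_and]
    exact ⟨fun h i t ht he => h i t ht he.symm, fun h i t ht he => h i t ht he.symm⟩
  rw [h1, card_compl, ZMod.card, card_biUnion]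
  · rw [Finset.sum_congr rfl (g := w)]
    · change m - ∑ v, w v = N
      omega
    · intro i _
      rw [card_image_of_injOn, card_range]
      intro s hs t ht hst
      simp only [coe_range, Set.mem_Iio] at hs ht
      have h2 := add_left_cancel hst
      have h3 := congrArg ZMod.val h2
      have := hwm i
      rwa [ZMod.val_cast_of_lt (by omega), ZMod.val_cast_of_lt (by omega)] at h3
  · intro i _ j _ hij
    change Disjoint _ _
    rw [Finset.disjoint_left]
    simp only [mem_image, mem_range, not_exists, not_and]
    rintro _ ⟨s, hs, rfl⟩ t ht he
    rcases le_total s t with h | h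
    · refine hQ j i hij.symm (t - s) (by omega) ?_
      rw [Nat.cast_sub h]; linear_combination -he
    · refine hQ i j hij (s - t) (by omega) ?_
      rw [Nat.cast_sub h]; linear_combination he

lemma card_valid {α ι : Type*} [Fintype α] [DecidableEq α] [Fintype ι] [DecidableEq ι]
    {k m o : ℕ} [NeZero m] [NeZero k] (hmk : m ∣ k) (hk : k = m * o)
    (w : ι → ℕ) (hw : ∀ i, 0 < w i) (N : ℕ) (hm : m = N + ∑ v, w v)
    (blk : α → Option ι) (hblk : ∀ i, ∃ a, blk a = some i) (a0 : α) (i0 : ι)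
    (h0 : blk a0 = some i0) :
    Set.ncard {p : α → ZMod k | p a0 = 0 ∧ ∀ i, ∃ c : ZMod m, ∀ a,
      (blk a = some i → ZMod.castHom hmk (ZMod m) (p a) = c) ∧
      (blk a ≠ some i → ∀ t < w i, ZMod.castHom hmk (ZMod m) (p a) ≠ c + (t : ZMod m))} =
    (N + Fintype.card ι - 1).descFactorial (Fintype.card ι - 1) *
      o ^ ((univ.filter fun a => blk a ≠ none).card - 1) *
      (o * N) ^ (Fintype.card α - (univ.filter fun a => blk a ≠ none).card) := by
  classical
  set π := ZMod.castHom hmk (ZMod m) with hπ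
  set PL := univ.filter fun Q : ι → ZMod m => Q i0 = 0 ∧
      ∀ i j, i ≠ j → ∀ t < w i, Q j ≠ Q i + (t : ZMod m) with hPL
  let allowed : (ι → ZMod m) → α → Finset (ZMod k) := fun Q a =>
    if a = a0 then {0} else univ.filter fun y =>
      (∀ i, blk a = some i → π y = Q i) ∧
      (blk a = none → π y ∈ univ.filter fun z : ZMod m => ∀ i, ∀ t < w i, z ≠ Q i + (t : ZMod m))
  -- all representatives satisfy the block conditions
  have hall : ∀ Q ∈ PL, ∀ p, p ∈ Fintype.piFinset (allowed Q) ↔ p a0 = 0 ∧ ∀ a,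
      (∀ i, blk a = some i → π (p a) = Q i) ∧
      (blk a = none → ∀ i, ∀ t < w i, π (p a) ≠ Q i + (t : ZMod m)) := by
    intro Q hQ p
    simp only [hPL, mem_filter, mem_univ, true_and] at hQ
    rw [Fintype.mem_piFinset]
    constructor
    · intro h
      have ha0 : p a0 = 0 := by simpa [allowed] using h a0
      refine ⟨ha0, fun a => ?_⟩
      by_cases ha : a = a0
      · subst ha
        rw [ha0, h0]
        refine ⟨fun i hi => ?_, fun h => by simp at h⟩
        obtain rfl := Option.some.inj hi
        rw [hQ.1, map_zero]
      · have := h a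
        simpa only [allowed, ha, if_false, mem_filter, mem_univ, true_and] using this
    · rintro ⟨ha0, h⟩ a
      by_cases ha : a = a0
      · subst ha; simp [allowed, ha0]
      · simpa only [allowed, ha, if_false, mem_filter, mem_univ, true_and] using h a
  have hset : {p : α → ZMod k | p a0 = 0 ∧ ∀ i, ∃ c : ZMod m, ∀ a,
      (blk a = some i → π (p a) = c) ∧
      (blk a ≠ some i → ∀ t < w i, π (p a) ≠ c + (t : ZMod m))} =
      ((PL.biUnion fun Q => Fintype.piFinset (allowed Q) : Finset (α → ZMod k)) :
        Set (α → ZMod k)) := by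
    ext p
    rw [Finset.mem_coe, mem_biUnion]
    constructor
    · rintro ⟨hp0, hp⟩
      choose Q hQ using hp
      have hQP : Q ∈ PL := by
        simp only [hPL, mem_filter, mem_univ, true_and]
        constructor
        · rw [← (hQ i0 a0).1 h0, hp0, map_zero]
        · intro i j hij t ht
          obtain ⟨a, ha⟩ := hblk j
          rw [← (hQ j a).1 ha]
          exact (hQ i a).2 (by rw [ha]; intro h; exact hij (Option.some.inj h).symm) t ht
      refine ⟨Q, hQP, (hall Q hQP p).2 ⟨hp0, fun a => ⟨fun i hi => (hQ i a).1 hi, ?_⟩⟩⟩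
      intro hn i t ht
      exact (hQ i a).2 (by rw [hn]; simp) t ht
    · rintro ⟨Q, hQ, hp⟩
      obtain ⟨hp0, h⟩ := (hall Q hQ p).1 hp
      simp only [hPL, mem_filter, mem_univ, true_and] at hQ
      refine ⟨hp0, fun i => ⟨Q i, fun a => ⟨(h a).1 i, fun hne t ht => ?_⟩⟩⟩
      rcases hb : blk a with _ | j
      · exact (h a).2 hb i t ht
      · rw [(h a).1 j hb]
        exact hQ.2 i j (by rintro rfl; exact hne hb) t ht
  rw [hset, Set.ncard_coe_finset, card_biUnion]
  · have hcard : ∀ Q ∈ PL, (Fintype.piFinset (allowed Q)).card =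
        o ^ ((univ.filter fun a => blk a ≠ none).card - 1) *
      (o * N) ^ (Fintype.card α - (univ.filter fun a => blk a ≠ none).card) := by
      intro Q hQ
      simp only [hPL, mem_filter, mem_univ, true_and] at hQ
      rw [Fintype.card_piFinset]
      have h1 : ∀ a, (allowed Q a).card =
          if a = a0 then 1 else if blk a ≠ none then o else o * N := by
        intro a
        by_cases ha : a = a0
        · simp [allowed, ha]
        · simp only [allowed, ha, if_false]
          rcases hb : blk a with _ | j
          · simp only [reduceCtorEq, false_imp_iff, implies_true, true_and, forall_true_left,
              ne_eq, not_true_eq_false, if_false]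
            rw [card_preim hmk hk, card_free m w N hm Q hQ.2]
          · rw [if_pos (by simp), ← card_fib hmk hk (Q j)]
            congr 1; ext y
            simp only [mem_filter, mem_univ, true_and, hπ]
            constructor
            · exact fun h => h.1 j rfl
            · exact fun h => ⟨fun i hi => by rw [← Option.some.inj hi]; exact h, fun h => by simp at h⟩
      rw [Finset.prod_congr rfl (fun a _ => h1 a), Finset.prod_ite, Finset.prod_const_one, one_mul,
        Finset.prod_ite, Finset.prod_const, Finset.prod_const]
      congr 2
      · rw [← Finset.card_erase_of_mem (s := univ.filter fun a => blk a ≠ none) (a := a0)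
          (by simp [h0])]
        congr 1; ext a; simp
      · rw [← Finset.card_compl]
        congr 1; ext a; simp only [mem_filter, mem_univ, true_and, mem_compl]
        constructor
        · exact fun h => h.2
        · intro h; refine ⟨?_, h⟩; rintro rfl; exact h (by simp [h0])
    rw [Finset.sum_congr rfl hcard, Finset.sum_const, hPL, card_placements m w hw i0 N hm,
      smul_eq_mul, mul_assoc]
  · intro Q hQ Q' hQ' hne
    change Disjoint _ _
    rw [Finset.disjoint_left]
    intro p hp hp'
    apply hne
    funext i
    obtain ⟨a, ha⟩ := hblk i
    rw [← (((hall Q hQ p).1 hp).2 a).1 i ha, ← (((hall Q' hQ' p).1 hp').2 a).1 i ha]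

end valid
section cyc

lemma pi_tau {k m : ℕ} [NeZero k] (τ : ZMod k) (hmk : m ∣ k)
    (hk : k = m * addOrderOf τ) : ZMod.castHom hmk (ZMod m) τ = 0 := by
  have h1 : addOrderOf τ • τ = 0 := addOrderOf_nsmul_eq_zero τ
  have ho : 0 < addOrderOf τ := addOrderOf_pos τ
  rw [← ZMod.natCast_zmod_val τ, nsmul_eq_mul, ← Nat.cast_mul, ZMod.natCast_zmod_val,
    ZMod.natCast_eq_zero_iff] at h1
  rw [← ZMod.natCast_zmod_val τ, map_natCast, ZMod.natCast_eq_zero_iff]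
  refine Nat.dvd_of_mul_dvd_mul_left ho ?_
  rw [mul_comm _ m, ← hk]
  exact h1

lemma pi_zero {k m : ℕ} [NeZero k] [NeZero m] (τ : ZMod k) (hmk : m ∣ k)
    (hk : k = m * addOrderOf τ) (x : ZMod k) (hx : ZMod.castHom hmk (ZMod m) x = 0) :
    ∃ t < addOrderOf τ, x = t • τ := by
  have h1 : (range (addOrderOf τ)).image (fun t : ℕ => t • τ) =
      univ.filter fun y : ZMod k => ZMod.castHom hmk (ZMod m) y = 0 := by
    apply Finset.eq_of_subset_of_card_le
    · intro y
      simp only [mem_image, mem_range, mem_filter, mem_univ, true_and]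
      rintro ⟨t, _, rfl⟩
      rw [map_nsmul, pi_tau τ hmk hk, smul_zero]
    · rw [card_fib hmk hk, card_image_of_injOn, card_range]
      have := nsmul_injOn_Iio_addOrderOf (x := τ)
      simpa using this
  have h2 : x ∈ univ.filter fun y : ZMod k => ZMod.castHom hmk (ZMod m) y = 0 := by
    simpa only [mem_filter, mem_univ, true_and] using hx
  rw [← h1] at h2
  simp only [mem_image, mem_range] at h2
  obtain ⟨t, ht, rfl⟩ := h2
  exact ⟨t, ht, rfl⟩

lemma card_cycle {n : ℕ} (σ : Equiv.Perm (Fin n)) (x : Fin n) :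
    (univ.filter fun y => σ.SameCycle x y).card = Function.minimalPeriod σ x := by
  have hper : 0 < Function.minimalPeriod σ x := by
    apply Function.minimalPeriod_pos_of_mem_periodicPts
    refine ⟨orderOf σ, orderOf_pos σ, ?_⟩
    change (σ^[orderOf σ]) x = x
    rw [← Equiv.Perm.coe_pow, pow_orderOf_eq_one]; rfl
  have : (univ.filter fun y => σ.SameCycle x y) =
      (range (Function.minimalPeriod σ x)).image fun t => σ^[t] x := by
    ext y
    simp only [mem_filter, mem_univ, true_and, mem_image, mem_range]
    constructor
    · intro h
      obtain ⟨t, ht⟩ := h.exists_nat_pow_eq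
      refine ⟨t % Function.minimalPeriod σ x, Nat.mod_lt _ hper, ?_⟩
      rw [Function.iterate_mod_minimalPeriod_eq, ← Equiv.Perm.coe_pow, ht]
    · rintro ⟨t, _, rfl⟩
      exact ⟨t, by rw [zpow_natCast, Equiv.Perm.coe_pow]⟩
  rw [this, card_image_of_injOn, card_range]
  simpa using Function.iterate_injOn_Iio_minimalPeriod (f := σ) (x := x)

lemma pow_eq_nsmul {n k : ℕ} (σ : Equiv.Perm (Fin n)) (x : Fin n) (τ : ZMod k)
    (ho : addOrderOf τ ∣ (univ.filter fun y => σ.SameCycle x y).card) (s t : ℕ)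
    (h : (σ ^ s) x = (σ ^ t) x) : s • τ = t • τ := by
  rw [card_cycle] at ho
  rw [nsmul_eq_nsmul_iff_modEq]
  refine Nat.ModEq.of_dvd ho ?_
  rw [Equiv.Perm.coe_pow, Equiv.Perm.coe_pow, ← Function.iterate_mod_minimalPeriod_eq,
    ← Function.iterate_mod_minimalPeriod_eq (n := t)] at h
  have hper : 0 < Function.minimalPeriod σ x := by
    rw [← card_cycle, Finset.card_pos]; exact ⟨x, by simp [Equiv.Perm.SameCycle.refl]⟩
  exact Function.iterate_injOn_Iio_minimalPeriod (Nat.mod_lt _ hper) (Nat.mod_lt _ hper) h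

lemma equiv_pow {n k : ℕ} (σ : Equiv.Perm (Fin n)) (τ : ZMod k) (f : Fin n → ZMod k)
    (hf : ∀ x, f (σ⁻¹ x) = f x + τ) (t : ℕ) (x : Fin n) : f x = f ((σ ^ t) x) + t • τ := by
  induction t with
  | zero => simp
  | succ t ih =>
    have := hf ((σ ^ (t+1)) x)
    rw [pow_succ' σ t, Equiv.Perm.mul_apply, Equiv.Perm.inv_def, Equiv.symm_apply_apply] at this
    rw [ih, this, pow_succ' σ t, Equiv.Perm.mul_apply, succ_nsmul]
    ring

/-- fibers in an invariant set all of whose values lie in one coset -/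
lemma card_fiber_mul {n k : ℕ} [NeZero k] (σ : Equiv.Perm (Fin n)) (τ : ZMod k)
    (f : Fin n → ZMod k)
    (hf : ∀ x, f (σ⁻¹ x) = f x + τ) (u : Finset (Fin n)) (hu : ∀ x, σ x ∈ u ↔ x ∈ u) (c : ZMod k)
    (hc : ∀ x ∈ u, ∃ t < addOrderOf τ, f x = c + t • τ) :
    (u.filter fun x => f x = c).card * addOrderOf τ = u.card := by
  have hup : ∀ t : ℕ, ∀ x, (σ ^ t) x ∈ u ↔ x ∈ u := by
    intro t; induction t with
    | zero => simp
    | succ t ih => intro x; rw [pow_succ' σ t, Equiv.Perm.mul_apply, hu, ih]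
  have h1 : ∀ t : ℕ, (u.filter fun x => f x = c + t • τ).card = (u.filter fun x => f x = c).card := by
    intro t
    refine Finset.card_bij (fun x _ => (σ ^ t) x) ?_ ?_ ?_
    · intro x hx
      simp only [mem_filter] at hx ⊢
      refine ⟨(hup t x).2 hx.1, ?_⟩
      have := equiv_pow σ τ f hf t x
      rw [hx.2] at this
      exact (add_right_cancel this).symm
    · intro x _ y _ h; exact (σ ^ t).injective h
    · intro y hy
      simp only [mem_filter] at hy
      refine ⟨(σ ^ t)⁻¹ y, ?_, by simp⟩
      simp only [mem_filter]
      refine ⟨(hup t _).1 (by simpa using hy.1), ?_⟩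
      rw [equiv_pow σ τ f hf t ((σ ^ t)⁻¹ y), Equiv.Perm.inv_def, Equiv.apply_symm_apply, hy.2]
  have h2 : u = (range (addOrderOf τ)).biUnion fun t => u.filter fun x => f x = c + t • τ := by
    ext x
    simp only [mem_biUnion, mem_range, mem_filter]
    constructor
    · intro hx
      obtain ⟨t, ht, h⟩ := hc x hx
      exact ⟨t, ht, hx, h⟩
    · rintro ⟨t, _, h, _⟩; exact h
  conv_rhs => rw [h2]
  rw [card_biUnion, Finset.sum_congr rfl (fun t _ => h1 t)]
  · simp [mul_comm]
  · intro s hs t ht hst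
    change Disjoint _ _
    rw [Finset.disjoint_left]
    intro x hx hx'
    simp only [mem_filter] at hx hx'
    apply hst
    apply nsmul_injOn_Iio_addOrderOf (x := τ) (by simpa using hs) (by simpa using ht)
    exact add_left_cancel (hx.2.symm.trans hx'.2)

lemma bad_iff {n k m r : ℕ} [NeZero k] [NeZero m] (σ : Equiv.Perm (Fin n))
    (C : Fin r → Finset (Fin n)) (rep : Fin r → Fin n)
    (hrep : ∀ a y, y ∈ C a ↔ σ.SameCycle (rep a) y)
    (idx : Fin n → Fin r) (hidx : ∀ a y, y ∈ C a ↔ idx y = a)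
    (τ : ZMod k) (hmk : m ∣ k) (hk : k = m * addOrderOf τ)
    (f : Fin n → ZMod k) (hf : ∀ x, f (σ⁻¹ x) = f x + τ)
    (S : Finset (Fin r)) (hS : S.Nonempty) (w : ℕ) (hw : (S.biUnion C).card = w * addOrderOf τ)
    (hwpos : 0 < w) (hwm : w ≤ m) :
    BadFor C f (S.biUnion C) ↔ ∃ c : ZMod m, ∀ a,
      (a ∈ S → ZMod.castHom hmk (ZMod m) (f (rep a)) = c) ∧
      (a ∉ S → ∀ t < w, ZMod.castHom hmk (ZMod m) (f (rep a)) ≠ c + (t : ZMod m)) := by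
  set π := ZMod.castHom hmk (ZMod m) with hπ
  have ho : 0 < addOrderOf τ := addOrderOf_pos τ
  have hmlek : m ≤ k := Nat.le_of_dvd (Nat.pos_of_ne_zero (NeZero.ne k)) hmk
  have hpf : ∀ a, ∀ y ∈ C a, π (f (rep a)) = π (f y) := by
    intro a y hy
    obtain ⟨t, ht⟩ := ((hrep a y).1 hy).exists_nat_pow_eq
    rw [equiv_pow σ τ f hf t (rep a), ht, map_add, map_nsmul, pi_tau τ hmk hk, smul_zero, add_zero]
  have hocc : ∀ a c, π (f (rep a)) = π c → ∃ y ∈ C a, f y = c := by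
    intro a c h
    obtain ⟨t, _, ht⟩ := pi_zero τ hmk hk (f (rep a) - c) (by rw [map_sub]; exact sub_eq_zero.2 h)
    refine ⟨(σ ^ t) (rep a), (hrep _ _).2 ⟨t, by rw [zpow_natCast]⟩, ?_⟩
    have := equiv_pow σ τ f hf t (rep a)
    rw [← ht] at this
    linear_combination -this
  have hCself : ∀ a, rep a ∈ C a := fun a => (hrep a _).2 (Equiv.Perm.SameCycle.refl _ _)
  have hmemu : ∀ y, y ∈ S.biUnion C ↔ idx y ∈ S := by
    intro y
    rw [mem_biUnion]
    constructor
    · rintro ⟨a, ha, hy⟩; rwa [(hidx a y).1 hy]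
    · intro h; exact ⟨_, h, (hidx _ y).2 rfl⟩
  have hidxσ : ∀ x, idx (σ x) = idx x := by
    intro x
    rw [← hidx, hrep]
    exact ((hrep _ x).1 ((hidx _ x).2 rfl)).trans ⟨1, by simp⟩
  have hsub : ∀ a, C a ⊆ S.biUnion C ↔ a ∈ S := by
    intro a
    constructor
    · intro h
      have := (hmemu _).1 (h (hCself a))
      rwa [(hidx a _).1 (hCself a)] at this
    · intro h; exact Finset.subset_biUnion_of_mem C h
  have hfibcard : ∀ c, (∀ a ∈ S, π (f (rep a)) = π c) →
      (univ.filter fun i => f i = c) ⊆ S.biUnion C → (univ.filter fun i => f i = c).card = w := by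
    intro c hc hsub
    have h1 := card_fiber_mul σ τ f hf (S.biUnion C)
      (fun x => by rw [hmemu, hmemu, hidxσ]) c (by
        intro x hx
        have h2 := hc _ ((hmemu x).1 hx)
        rw [hpf _ x ((hidx _ x).2 rfl)] at h2
        obtain ⟨t, ht, h3⟩ := pi_zero τ hmk hk (f x - c) (by rw [map_sub]; exact sub_eq_zero.2 h2)
        exact ⟨t, ht, by rw [← h3]; ring⟩)
    rw [hw] at h1
    have h2 := Nat.eq_of_mul_eq_mul_right ho h1
    rw [← h2]
    congr 1
    ext x
    simp only [mem_filter, mem_univ, true_and]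
    exact ⟨fun h => ⟨hsub (by simp [h]), h⟩, fun h => h.2⟩
  constructor
  · rintro ⟨c, _, hgap, hfu, hmeet⟩
    have hin : ∀ a ∈ S, π (f (rep a)) = π c := by
      intro a ha
      obtain ⟨y, hy⟩ := hmeet a ((hsub a).2 ha)
      simp only [mem_inter, mem_filter, mem_univ, true_and] at hy
      rw [hpf a y hy.2, hy.1]
    rw [hfibcard c hin hfu] at hgap
    refine ⟨π c, fun a => ⟨hin a, fun ha t ht he => ?_⟩⟩
    obtain ⟨y, hy, hfy⟩ := hocc a (c + (t : ZMod k)) (by rw [he, map_add, map_natCast])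
    rcases Nat.eq_zero_or_pos t with h0 | h0
    · subst h0
      have := hfu (show y ∈ univ.filter fun i => f i = c by simp [hfy])
      rw [hmemu, (hidx a y).1 hy] at this
      exact ha this
    · have : gapLen f c ≤ t := Nat.sInf_le ⟨h0, by omega, y, hfy⟩
      omega
  · rintro ⟨c, hc⟩
    obtain ⟨c', rfl⟩ := ZMod.castHom_surjective hmk c
    have hin : ∀ a ∈ S, π (f (rep a)) = π c' := fun a ha => (hc a).1 ha
    have hfu : (univ.filter fun i => f i = c') ⊆ S.biUnion C := by
      intro y hy
      simp only [mem_filter, mem_univ, true_and] at hy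
      rw [hmemu]
      by_contra hn
      refine (hc _).2 hn 0 hwpos ?_
      rw [hpf _ y ((hidx _ y).2 rfl), hy]; simp [hπ]
    obtain ⟨b, hb⟩ := hS
    obtain ⟨y0, _, hy0⟩ := hocc b c' (hin b hb)
    refine ⟨c', ⟨y0, hy0⟩, ?_, hfu, ?_⟩
    · rw [hfibcard c' hin hfu]
      refine le_csInf ⟨k, Nat.pos_of_ne_zero (NeZero.ne k), le_rfl, y0, by simp [hy0]⟩ ?_
      rintro l ⟨hl1, _, y, hy⟩
      by_contra hlt
      push Not at hlt
      have hpy : π (f (rep (idx y))) = π c' + (l : ZMod m) := by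
        rw [hpf _ y ((hidx _ y).2 rfl), hy, map_add, map_natCast]
      by_cases hin' : idx y ∈ S
      · rw [hin _ hin'] at hpy
        have h0 : (l : ZMod m) = 0 := by linear_combination -hpy
        rw [ZMod.natCast_eq_zero_iff] at h0
        have := Nat.le_of_dvd hl1 h0
        omega
      · exact (hc _).2 hin' l hlt hpy
    · intro a ha
      obtain ⟨y, hy, hfy⟩ := hocc a c' (hin a ((hsub a).1 ha))
      exact ⟨y, by simp [hy, hfy]⟩

end cyc
/-- Lemma: for 2 ≤ k < n, σ ∈ S_n with cycle sets C_1,…,C_r, g = gcd(s_1,…,s_r,k),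
τ with g·τ = 0, 1 ≤ h ≤ k−1 and a collection 𝒥 of h pairwise disjoint elements of Λ
(encoded by their index sets, which are nonempty and pairwise disjoint), with
j = |⋃ ind(u)| and i = |⋃ u| ≤ k−1, the intersection ⋂_{u∈J} 𝓓^τ_u of the sets of
σ-fixed non-hypersimplicial DOSPs with turning number τ having a bad-set orbit
spanning u has cardinality
((k−i)/o(τ) + h − 1)!/((k−i)/o(τ))! · o(τ)^{j−1} · (k−i)^{r−j}. -/
theorem card_inter_bad_dosps {n k r : ℕ} (hk : 2 ≤ k) (hkn : k < n)
    (σ : Equiv.Perm (Fin n)) (C : Fin r → Finset (Fin n))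
    (hC : Finset.image C Finset.univ = cycleSets σ) (hCinj : Function.Injective C)
    (τ : ZMod k) (hτ : (Nat.gcd (Finset.univ.gcd fun a => (C a).card) k) • τ = 0)
    (h : ℕ) (hh1 : 1 ≤ h) (hhk : h ≤ k - 1)
    (𝒥 : Finset (Finset (Fin r))) (hJcard : 𝒥.card = h)
    (hJne : ∀ S ∈ 𝒥, S.Nonempty)
    (hJdisj : ∀ S ∈ 𝒥, ∀ T ∈ 𝒥, S ≠ T → Disjoint (S.biUnion C) (T.biUnion C))
    (hi : (𝒥.biUnion fun S => S.biUnion C).card ≤ k - 1) :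
    Set.ncard {D : Quotient (dospSetoid n k) |
        ∀ S ∈ 𝒥, ∃ f : Fin n → ZMod k, Quotient.mk (dospSetoid n k) f = D ∧
          (∀ x, f (σ⁻¹ x) = f x + τ) ∧ ¬ Hypersimplicial f ∧ BadFor C f (S.biUnion C)} =
      Nat.factorial ((k - (𝒥.biUnion fun S => S.biUnion C).card) / addOrderOf τ + h - 1) /
          Nat.factorial ((k - (𝒥.biUnion fun S => S.biUnion C).card) / addOrderOf τ) *
        addOrderOf τ ^ ((𝒥.biUnion id).card - 1) *
        (k - (𝒥.biUnion fun S => S.biUnion C).card) ^ (r - (𝒥.biUnion id).card) := by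
  classical
  haveI : NeZero k := ⟨by omega⟩
  set o := addOrderOf τ with ho_def
  have ho : 0 < o := addOrderOf_pos τ
  have hok : o ∣ k := by
    refine addOrderOf_dvd_of_nsmul_eq_zero ?_
    rw [nsmul_eq_mul]; simp
  obtain ⟨m, hkm'⟩ := hok
  have hkm : k = m * o := by rw [hkm', mul_comm]
  have hmk : m ∣ k := ⟨o, hkm⟩
  haveI : NeZero m := ⟨by rintro rfl; omega⟩
  have hoC : ∀ a, o ∣ (C a).card := by
    intro a
    have h1 := addOrderOf_dvd_of_nsmul_eq_zero hτ
    exact (h1.trans (Nat.gcd_dvd_left _ _)).trans (Finset.gcd_dvd (mem_univ a))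
  -- representatives of the cycles
  have hrep0 : ∀ a, ∃ x, C a = univ.filter fun y => σ.SameCycle x y := by
    intro a
    have h1 : C a ∈ cycleSets σ := by rw [← hC]; exact mem_image_of_mem C (mem_univ a)
    unfold cycleSets at h1
    obtain ⟨x, _, hx⟩ := mem_image.1 h1
    exact ⟨x, hx.symm⟩
  choose rep hrepC using hrep0
  have hrep : ∀ a y, y ∈ C a ↔ σ.SameCycle (rep a) y := by
    intro a y; rw [hrepC a]; simp
  have hidx0 : ∀ y, ∃ a, y ∈ C a := by
    intro y
    have h1 : (univ.filter fun z => σ.SameCycle y z) ∈ cycleSets σ :=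
      mem_image_of_mem (fun x => univ.filter fun z => σ.SameCycle x z) (mem_univ y)
    rw [← hC] at h1
    obtain ⟨a, _, ha⟩ := mem_image.1 h1
    exact ⟨a, by rw [ha]; simp [Equiv.Perm.SameCycle.refl]⟩
  choose idx hidxC using hidx0
  have huniq : ∀ a b y, y ∈ C a → y ∈ C b → a = b := by
    intro a b y ha hb
    apply hCinj
    ext z
    rw [hrep] at ha hb ⊢
    rw [hrep]
    exact ⟨fun h => (hb.trans ha.symm).trans h, fun h => (ha.trans hb.symm).trans h⟩
  have hidx : ∀ a y, y ∈ C a ↔ idx y = a := by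
    intro a y
    constructor
    · exact fun h => huniq _ _ y (hidxC y) h
    · rintro rfl; exact hidxC y
  have hCself : ∀ a, rep a ∈ C a := fun a => (hrep a _).2 (Equiv.Perm.SameCycle.refl _ _)
  have hidxrep : ∀ a, idx (rep a) = a := fun a => (hidx a _).1 (hCself a)
  -- blocks
  have hJ2 : ∀ S ∈ 𝒥, ∀ T ∈ 𝒥, ∀ a, a ∈ S → a ∈ T → S = T := by
    intro S hS T hT a haS haT
    by_contra hne
    exact (Finset.disjoint_left.1 (hJdisj S hS T hT hne)) (mem_biUnion.2 ⟨a, haS, hCself a⟩)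
      (mem_biUnion.2 ⟨a, haT, hCself a⟩)
  let blk : Fin r → Option 𝒥 := fun a =>
    if hex : ∃ S : 𝒥, a ∈ S.1 then some hex.choose else none
  have hblk : ∀ a (S : 𝒥), blk a = some S ↔ a ∈ S.1 := by
    intro a S
    by_cases hex : ∃ S : 𝒥, a ∈ S.1
    · have h1 : blk a = some hex.choose := dif_pos hex
      rw [h1]
      constructor
      · intro h2; rw [← Option.some.inj h2]; exact hex.choose_spec
      · intro h2
        congr 1
        exact Subtype.ext (hJ2 _ hex.choose.2 _ S.2 a hex.choose_spec h2)
    · have h1 : blk a = none := dif_neg hex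
      rw [h1]
      simp only [reduceCtorEq, false_iff]
      exact fun h2 => hex ⟨S, h2⟩
  have hblkn : ∀ a, blk a ≠ none ↔ a ∈ 𝒥.biUnion id := by
    intro a
    rw [Option.ne_none_iff_exists', mem_biUnion]
    constructor
    · rintro ⟨S, hS⟩; exact ⟨S.1, S.2, (hblk a S).1 hS⟩
    · rintro ⟨S, hS, ha⟩; exact ⟨⟨S, hS⟩, (hblk a ⟨S, hS⟩).2 ha⟩
  -- weights
  have hSdvd : ∀ S : Finset (Fin r), o ∣ (S.biUnion C).card := by
    intro S
    rw [card_biUnion]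
    · exact Finset.dvd_sum fun a _ => hoC a
    · intro a _ b _ hab
      change Disjoint _ _
      rw [Finset.disjoint_left]
      exact fun y ha hb => hab (huniq a b y ha hb)
  let w : 𝒥 → ℕ := fun S => (S.1.biUnion C).card / o
  have hw : ∀ S : 𝒥, (S.1.biUnion C).card = w S * o := fun S =>
    (Nat.div_mul_cancel (hSdvd S.1)).symm
  have hwpos : ∀ S : 𝒥, 0 < w S := by
    intro S
    obtain ⟨a, ha⟩ := hJne S.1 S.2
    have : 0 < (S.1.biUnion C).card := Finset.card_pos.2 ⟨rep a, mem_biUnion.2 ⟨a, ha, hCself a⟩⟩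
    rw [hw S] at this
    exact Nat.pos_of_mul_pos_right this
  have hi_eq : (𝒥.biUnion fun S => S.biUnion C).card = (∑ S, w S) * o := by
    rw [card_biUnion]
    · rw [← Finset.sum_coe_sort, Finset.sum_mul]
      exact Finset.sum_congr rfl fun S _ => hw S
    · intro S hS T hT hne
      exact hJdisj S hS T hT hne
  rw [hi_eq] at hi ⊢
  have hWm : ∑ S, w S < m := by
    have : (∑ S, w S) * o < m * o := by rw [← hkm]; omega
    exact Nat.lt_of_mul_lt_mul_right this
  obtain ⟨N, hN⟩ : ∃ N, m = N + ∑ S, w S := ⟨m - ∑ S, w S, by omega⟩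
  have hkN : k - (∑ S, w S) * o = o * N := by
    rw [hkm, hN, add_mul, Nat.add_sub_cancel, mul_comm]
  have hwm : ∀ S, w S ≤ m := fun S => by
    have := Finset.single_le_sum (f := w) (fun _ _ => Nat.zero_le _) (mem_univ S)
    omega
  obtain ⟨S0, hS0⟩ : 𝒥.Nonempty := Finset.card_pos.1 (by omega)
  obtain ⟨a0, ha0⟩ := hJne S0 hS0
  have hbad : ∀ f : Fin n → ZMod k, (∀ x, f (σ⁻¹ x) = f x + τ) → ∀ S : 𝒥,
      (BadFor C f (S.1.biUnion C) ↔ ∃ c : ZMod m, ∀ a,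
      (a ∈ S.1 → ZMod.castHom hmk (ZMod m) (f (rep a)) = c) ∧
      (a ∉ S.1 → ∀ t < w S, ZMod.castHom hmk (ZMod m) (f (rep a)) ≠ c + (t : ZMod m))) :=
    fun f hf S => bad_iff σ C rep hrep idx hidx τ hmk hkm f hf S.1 (hJne S.1 S.2) (w S) (hw S)
      (hwpos S) (hwm S)
  have hmain := card_valid hmk hkm w hwpos N hN blk
    (fun S => by
      obtain ⟨a, ha⟩ := hJne S.1 S.2
      exact ⟨a, (hblk a S).2 ha⟩) a0 ⟨S0, hS0⟩ ((hblk a0 ⟨S0, hS0⟩).2 ha0)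
  -- the normalised functions
  set F0 : Set (Fin n → ZMod k) := {f | (∀ x, f (σ⁻¹ x) = f x + τ) ∧ f (rep a0) = 0 ∧
    ∀ S : 𝒥, BadFor C f (S.1.biUnion C)} with hF0
  have hpset : {p : Fin r → ZMod k | p a0 = 0 ∧ ∀ i, ∃ c : ZMod m, ∀ a,
      (blk a = some i → ZMod.castHom hmk (ZMod m) (p a) = c) ∧
      (blk a ≠ some i → ∀ t < w i, ZMod.castHom hmk (ZMod m) (p a) ≠ c + (t : ZMod m))} =
      (fun f : Fin n → ZMod k => fun a => f (rep a)) '' F0 := by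
    ext p
    constructor
    · rintro ⟨hp0, hp⟩
      have hex : ∀ y, ∃ t : ℕ, (σ ^ t) (rep (idx y)) = y := fun y =>
        ((hrep _ y).1 (hidxC y)).exists_nat_pow_eq
      choose T hT using hex
      let f : Fin n → ZMod k := fun y => p (idx y) - T y • τ
      have hoc : ∀ a, addOrderOf τ ∣ (univ.filter fun y => σ.SameCycle (rep a) y).card := by
        intro a; rw [← hrepC a]; exact hoC a
      have hfe : ∀ x, f (σ⁻¹ x) = f x + τ := by
        intro x
        have h1 : idx (σ⁻¹ x) = idx x := by
          rw [← hidx, hrep]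
          exact ((hrep _ x).1 (hidxC x)).trans ⟨-1, by simp⟩
        have h2 : (σ ^ (T (σ⁻¹ x) + 1)) (rep (idx x)) = (σ ^ (T x)) (rep (idx x)) := by
          rw [pow_succ' σ, Equiv.Perm.mul_apply, hT x]
          have := hT (σ⁻¹ x)
          rw [h1] at this
          rw [this, Equiv.Perm.inv_def, Equiv.apply_symm_apply]
        have h3 := pow_eq_nsmul σ _ τ (hoc (idx x)) _ _ h2
        change p (idx (σ⁻¹ x)) - T (σ⁻¹ x) • τ = p (idx x) - T x • τ + τ
        rw [h1, ← h3, succ_nsmul]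
        ring
      have hfr : ∀ a, f (rep a) = p a := by
        intro a
        have h2 : (σ ^ (T (rep a))) (rep a) = (σ ^ 0) (rep a) := by
          have := hT (rep a)
          rw [hidxrep] at this
          rw [this]; rfl
        have h3 := pow_eq_nsmul σ _ τ (hoc a) _ _ h2
        change p (idx (rep a)) - T (rep a) • τ = p a
        rw [h3, hidxrep]; simp
      refine ⟨f, ⟨hfe, by rw [hfr, hp0], fun S => (hbad f hfe S).2 ?_⟩, funext hfr⟩
      obtain ⟨c, hc⟩ := hp S
      refine ⟨c, fun a => ?_⟩
      rw [hfr, ← hblk]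
      exact hc a
    · rintro ⟨f, ⟨hfe, hf0, hfb⟩, rfl⟩
      refine ⟨hf0, fun S => ?_⟩
      obtain ⟨c, hc⟩ := (hbad f hfe S).1 (hfb S)
      refine ⟨c, fun a => ?_⟩
      have := hc a
      rwa [← hblk] at this
  have hinj1 : Set.InjOn (fun f : Fin n → ZMod k => fun a => f (rep a)) F0 := by
    rintro f ⟨hf, _⟩ g ⟨hg, _⟩ hfg
    funext y
    obtain ⟨t, ht⟩ := ((hrep _ y).1 (hidxC y)).exists_nat_pow_eq
    have h1 := equiv_pow σ τ f hf t (rep (idx y))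
    have h2 := equiv_pow σ τ g hg t (rep (idx y))
    have h3 : f (rep (idx y)) = g (rep (idx y)) := congrFun hfg (idx y)
    rw [ht] at h1 h2
    rw [h1, h2] at h3
    exact add_right_cancel h3
  have hDset : {D : Quotient (dospSetoid n k) |
        ∀ S ∈ 𝒥, ∃ f : Fin n → ZMod k, Quotient.mk (dospSetoid n k) f = D ∧
          (∀ x, f (σ⁻¹ x) = f x + τ) ∧ ¬ Hypersimplicial f ∧ BadFor C f (S.biUnion C)} =
      (Quotient.mk (dospSetoid n k)) '' F0 := by
    ext D
    constructor
    · intro hD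
      obtain ⟨f, hfD, hfe, _, _⟩ := hD S0 hS0
      let g : Fin n → ZMod k := fun x => f x - f (rep a0)
      have hge : ∀ x, g (σ⁻¹ x) = g x + τ := by
        intro x
        change f (σ⁻¹ x) - f (rep a0) = f x - f (rep a0) + τ
        rw [hfe]; ring
      refine ⟨g, ⟨hge, sub_self _, fun S => ?_⟩, ?_⟩
      · obtain ⟨f', hf'D, hf'e, _, hf'b⟩ := hD S.1 S.2
        have hrel : (dospSetoid n k).r f f' := Quotient.exact (hfD.trans hf'D.symm)
        obtain ⟨d, hd⟩ := hrel
        rw [hbad g hge S]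
        obtain ⟨c, hc⟩ := (hbad f' hf'e S).1 hf'b
        have hgf : ∀ x, g x = f' x + (d - f (rep a0)) := by
          intro x
          change f x - f (rep a0) = _
          rw [hd x]; ring
        refine ⟨c + ZMod.castHom hmk (ZMod m) (d - f (rep a0)), fun a => ⟨fun ha => ?_,
          fun ha t ht he => ?_⟩⟩
        · rw [hgf, map_add, (hc a).1 ha]
        · rw [hgf, map_add] at he
          exact (hc a).2 ha t ht (by linear_combination he)
      · rw [← hfD]
        apply Quotient.sound
        exact ⟨-f (rep a0), fun x => sub_eq_add_neg _ _⟩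
    · rintro ⟨f, ⟨hfe, _, hfb⟩, rfl⟩ S hS
      refine ⟨f, rfl, hfe, ?_, hfb ⟨S, hS⟩⟩
      obtain ⟨c, hc1, hc2, _⟩ := hfb ⟨S, hS⟩
      intro hyp
      exact absurd (hyp c hc1) (not_lt.2 hc2)
  have hinj2 : Set.InjOn (Quotient.mk (dospSetoid n k)) F0 := by
    rintro f ⟨_, hf0, _⟩ g ⟨_, hg0, _⟩ hfg
    have hrel : (dospSetoid n k).r f g := Quotient.exact hfg
    obtain ⟨d, hd⟩ := hrel
    have h1 := hd (rep a0)
    rw [hf0, hg0, zero_add] at h1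
    funext x
    rw [hd x, ← h1, add_zero]
  rw [hDset, hinj2.ncard_image, ← hinj1.ncard_image, ← hpset, hmain]
  have hfilt : (univ.filter fun a => blk a ≠ none) = 𝒥.biUnion id := by
    ext a
    rw [mem_filter, hblkn]; simp
  rw [hfilt, Fintype.card_coe, hJcard, Fintype.card_fin, hkN, Nat.mul_div_cancel_left _ ho,
    Nat.descFactorial_eq_div (by omega), show N + h - 1 - (h - 1) = N by omega]
end

section
/- Fix integers 2 ≤ k < n and a permutation σ ∈ S_n with cycle lengths s_1,…,s_r, let λ_i be the number of length-i cycles of σ, let g = gcd(s_1,…,s_r,k), and let T = {τ ∈ ℤ/kℤ : g·τ = 0}. Then the number of σ-fixed non-hypersimplicial (k,n)-DOSPs equals Σ_{τ∈T} Σ_{h=1}^{k−1} (−1)^{h+1} Σ_{i=h}^{k−1} Σ_{j=1}^{i} ( ∏_{b=1}^{h−1} ((k−i)/o(τ) + b) ) · o(τ)^{j−1} · (k−i)^{r−j} · ( Σ_{I ∈ 𝓘_i, |I| = j} C(λ_1,I_1)⋯C(λ_{k−1},I_{k−1}) ) · S(j,h), an identity of rational numbers, where S(j,h) is the Stirling number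 of the second kind, o(τ) is the order of τ in ℤ/kℤ, C(a,b) is the binomial coefficient, and ∏_{b=1}^{h−1}((k−i)/o(τ)+b) = ((k−i)/o(τ)+h−1)!/((k−i)/o(τ))! is interpreted in ℚ (the empty product for h = 1 being 1). -/
open Finset

/-- λ_i : the number of cycles of σ of length i (fixed points count as 1-cycles). -/
def cycleCount {n : ℕ} (σ : Equiv.Perm (Fin n)) (i : ℕ) : ℕ :=
  ((cycleSets σ).filter fun C => C.card = i).card

/-- 𝓘_h : the (k−1)-tuples I of non-negative integers with Σ_{i=1}^{k-1} i·I_i = h. -/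
def Iset (k h : ℕ) : Finset (Fin (k-1) → ℕ) :=
  ((Finset.univ : Finset (Fin (k-1) → Fin (h+1))).filter
    fun I => ∑ i : Fin (k-1), ((i : ℕ) + 1) * (I i : ℕ) = h).image fun I i => (I i : ℕ)

/-- Stirling numbers of the second kind: the number of partitions of a j-element set
    into h non-empty unlabelled parts. -/
noncomputable def stirling2 (j h : ℕ) : ℕ :=
  Set.ncard {P : Finpartition (Finset.univ : Finset (Fin j)) | P.parts.card = h}


section Lin
variable {ι : Type*} [DecidableEq ι] [Fintype ι]

/-- linear placements of labelled intervals -/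
def linPl (a : ι → ℕ) (S : Finset ι) (L : ℕ) : Finset (ι → ℕ) :=
  (Fintype.piFinset fun p => if p ∈ S then range L else {0}).filter fun c =>
    (∀ p ∈ S, c p + a p ≤ L) ∧ ∀ p ∈ S, ∀ q ∈ S, p ≠ q → c p + a p ≤ c q ∨ c q + a q ≤ c p

theorem mem_linPl {a : ι → ℕ} (ha : ∀ i, 0 < a i) {S : Finset ι} {L : ℕ} {c : ι → ℕ} :
    c ∈ linPl a S L ↔ (∀ p, p ∉ S → c p = 0) ∧ (∀ p ∈ S, c p + a p ≤ L) ∧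
      ∀ p ∈ S, ∀ q ∈ S, p ≠ q → c p + a p ≤ c q ∨ c q + a q ≤ c p := by
  simp only [linPl, mem_filter, Fintype.mem_piFinset]
  constructor
  · rintro ⟨h1, h2, h3⟩
    refine ⟨fun p hp => ?_, h2, h3⟩
    have := h1 p
    simpa [hp] using this
  · rintro ⟨h1, h2, h3⟩
    refine ⟨fun p => ?_, h2, h3⟩
    by_cases hp : p ∈ S
    · have := h2 p hp
      have := ha p
      simp [hp]; omega
    · simp [hp, h1 p hp]

theorem linPl_sum_le {a : ι → ℕ} (ha : ∀ i, 0 < a i) {S : Finset ι} {L : ℕ} {c : ι → ℕ}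
    (hc : c ∈ linPl a S L) : ∑ p ∈ S, a p ≤ L := by
  rw [mem_linPl ha] at hc
  obtain ⟨-, h2, h3⟩ := hc
  have hd : (S : Set ι).PairwiseDisjoint fun p => Ico (c p) (c p + a p) := by
    intro p hp q hq hpq
    simp only [Function.onFun]
    rw [Finset.disjoint_left]
    intro x hx hy
    simp only [mem_Ico] at hx hy
    have := h3 p hp q hq hpq
    omega
  have : (S.biUnion fun p => Ico (c p) (c p + a p)).card ≤ (range L).card := by
    apply card_le_card
    intro x hx
    simp only [mem_biUnion, mem_Ico, mem_range] at *
    obtain ⟨p, hp, h⟩ := hx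
    have := h2 p hp
    omega
  rw [card_biUnion hd] at this
  simpa using this

theorem linPl_last {a : ι → ℕ} (ha : ∀ i, 0 < a i) {S : Finset ι} {L : ℕ} {p : ι} (hp : p ∈ S)
    (hL : a p ≤ L) :
    ((linPl a S L).filter fun c => c p + a p = L).card = (linPl a (S.erase p) (L - a p)).card := by
  refine Finset.card_bij' (fun c _ => Function.update c p 0)
    (fun c _ => Function.update c p (L - a p)) ?_ ?_ ?_ ?_
  · intro c hc
    simp only [mem_filter, mem_linPl ha] at hc ⊢
    obtain ⟨⟨h1, h2, h3⟩, h4⟩ := hc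
    refine ⟨?_, ?_, ?_⟩
    · intro q hq
      by_cases hqp : q = p
      · simp [hqp]
      · simp only [mem_erase, not_and] at hq
        simp [hqp, h1 q (hq hqp)]
    · intro q hq
      simp only [mem_erase] at hq
      have := h3 q hq.2 p hp hq.1
      have := h2 q hq.2
      have := ha q
      simp [hq.1]; omega
    · intro q hq q' hq' hne
      simp only [mem_erase] at hq hq'
      simpa [hq.1, hq'.1] using h3 q hq.2 q' hq'.2 hne
  · intro c hc
    simp only [mem_filter, mem_linPl ha] at hc ⊢
    obtain ⟨h1, h2, h3⟩ := hc
    refine ⟨⟨?_, ?_, ?_⟩, ?_⟩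
    · intro q hq
      have hqp : q ≠ p := fun h => hq (h ▸ hp)
      simp [hqp, h1 q (by simp [hq])]
    · intro q hq
      by_cases hqp : q = p
      · subst hqp; simp; omega
      · have := h2 q (by simp [hq, hqp])
        simp [hqp]; omega
    · intro q hq q' hq' hne
      by_cases hqp : q = p
      · subst hqp
        have := h2 q' (by simp [hq', hne.symm])
        simp [hne.symm]; omega
      · by_cases hqp' : q' = p
        · subst hqp'
          have := h2 q (by simp [hq, hne])
          simp [hne]; omega
        · simpa [hqp, hqp'] using h3 q (by simp [hq, hqp]) q' (by simp [hq', hqp']) hne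
    · simp; omega
  · intro c hc
    simp only [mem_filter] at hc
    have : L - a p = c p := by omega
    simp [this]
  · intro c hc
    rw [mem_linPl ha] at hc
    have := hc.1 p (by simp)
    simp only [Function.update_idem]
    rw [← this, Function.update_eq_self]

theorem linPl_succ {a : ι → ℕ} (ha : ∀ i, 0 < a i) (S : Finset ι) (L : ℕ)
    (hS : ∀ p ∈ S, a p ≤ L + 1) :
    (linPl a S (L+1)).card = (linPl a S L).card +
      ∑ p ∈ S, (linPl a (S.erase p) (L + 1 - a p)).card := by
  have hE : linPl a S (L+1) = linPl a S L ∪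
      S.biUnion fun p => (linPl a S (L+1)).filter fun c => c p + a p = L + 1 := by
    ext c
    simp only [mem_union, mem_biUnion, mem_filter, mem_linPl ha]
    constructor
    · rintro ⟨h1, h2, h3⟩
      by_cases h : ∃ p ∈ S, c p + a p = L + 1
      · right
        obtain ⟨p, hp, h⟩ := h
        exact ⟨p, hp, ⟨h1, h2, h3⟩, h⟩
      · left
        push Not at h
        refine ⟨h1, fun p hp => ?_, h3⟩
        have := h2 p hp
        have := h p hp
        omega
    · rintro (⟨h1, h2, h3⟩ | ⟨p, hp, h, -⟩)
      · exact ⟨h1, fun p hp => by have := h2 p hp; omega, h3⟩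
      · exact h
  rw [hE, card_union_of_disjoint, card_biUnion]
  · congr 1
    exact sum_congr rfl fun p hp => linPl_last ha hp (hS p hp)
  · intro p hp q hq hpq
    simp only [Function.onFun]
    rw [Finset.disjoint_left]
    intro c hc hc'
    simp only [mem_filter, mem_linPl ha] at hc hc'
    have := hc.1.2.2 p hp q hq hpq
    have := ha p
    have := ha q
    omega
  · rw [Finset.disjoint_left]
    intro c hc hc'
    simp only [mem_biUnion, mem_filter, mem_linPl ha] at hc hc'
    obtain ⟨p, hp, -, h⟩ := hc'
    have := hc.2.1 p hp
    omega

theorem card_linPl {a : ι → ℕ} (ha : ∀ i, 0 < a i) (L : ℕ) : ∀ (S : Finset ι),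
    ∑ p ∈ S, a p ≤ L → (linPl a S L).card = (L - ∑ p ∈ S, a p + 1).ascFactorial S.card := by
  induction L using Nat.strong_induction_on with
  | _ L ih =>
  intro S hS
  rcases S.eq_empty_or_nonempty with rfl | hne
  · have : linPl a ∅ L = {0} := by
      ext c
      simp [mem_linPl ha, funext_iff]
    simp [this]
  have hle : ∀ p ∈ S, a p ≤ ∑ p ∈ S, a p := fun p hp =>
    single_le_sum (f := a) (fun _ _ => Nat.zero_le _) hp
  obtain ⟨p0, hp0⟩ := hne
  obtain ⟨L, rfl⟩ : ∃ L', L = L' + 1 := ⟨L - 1, by have := hle p0 hp0; have := ha p0; omega⟩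
  rw [linPl_succ ha S L (fun p hp => (hle p hp).trans hS)]
  obtain ⟨h, hh⟩ : ∃ h, S.card = h + 1 := ⟨S.card - 1, by have := card_pos.2 ⟨p0, hp0⟩; omega⟩
  have h2 : ∀ p ∈ S, (linPl a (S.erase p) (L + 1 - a p)).card =
      (L + 1 - ∑ p ∈ S, a p + 1).ascFactorial h := by
    intro p hp
    have he := add_sum_erase S a hp
    have := ha p
    rw [ih _ (by omega) _ (by omega), card_erase_of_mem hp, hh]
    congr 1
    omega
  rw [sum_congr rfl h2, sum_const, hh, smul_eq_mul]
  have h1 : (linPl a S L).card = (L + 1 - ∑ p ∈ S, a p).ascFactorial (h + 1) := by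
    by_cases hc : ∑ p ∈ S, a p ≤ L
    · rw [ih L (by omega) S hc, hh]; congr 1; omega
    · have : L + 1 - ∑ p ∈ S, a p = 0 := by omega
      rw [this, Nat.zero_ascFactorial, card_eq_zero, eq_empty_iff_forall_notMem]
      intro c hc'
      exact hc (linPl_sum_le ha hc')
  rw [h1]
  generalize L + 1 - ∑ p ∈ S, a p = m
  have h3 := Nat.succ_ascFactorial m h
  rw [Nat.ascFactorial_succ (n := m+1), Nat.ascFactorial_succ (n := m), ← h3]
  simp only [Nat.succ_eq_add_one]
  ring
end Lin

theorem zsub_val {K : ℕ} [NeZero K] (x y : ZMod K) :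
    (y - x).val + x.val = y.val ∨ (y - x).val + x.val = y.val + K := by
  by_cases h : (y - x).val + x.val < K
  · left
    have := ZMod.val_add_of_lt h
    rw [sub_add_cancel] at this
    exact this.symm
  · right
    have := ZMod.val_add_val_of_le (not_lt.1 h)
    rwa [sub_add_cancel] at this

section Circ
variable {ι : Type*} [DecidableEq ι] [Fintype ι]

/-- circular placements of labelled arcs -/
def circPl (K : ℕ) [NeZero K] (a : ι → ℕ) : Finset (ι → ZMod K) :=
  univ.filter fun c => ∀ p q, p ≠ q → a p ≤ (c q - c p).val

theorem mem_circPl {K : ℕ} [NeZero K] {a : ι → ℕ} {c : ι → ZMod K} :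
    c ∈ circPl K a ↔ ∀ p q, p ≠ q → a p ≤ (c q - c p).val := by
  simp [circPl]

theorem card_circPl (K : ℕ) [NeZero K] (a : ι → ℕ) (ha : ∀ i, 0 < a i) (p0 : ι)
    (hK : ∑ p, a p ≤ K) :
    (circPl K a).card = K * (K - ∑ p, a p + 1).ascFactorial (Fintype.card ι - 1) := by
  have hs := add_sum_erase univ a (mem_univ p0)
  have h1 := card_linPl ha (K - a p0) (univ.erase p0) (by omega)
  have h2 : K - a p0 - ∑ p ∈ univ.erase p0, a p = K - ∑ p, a p := by omega
  rw [h2, card_erase_of_mem (mem_univ _), card_univ] at h1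
  rw [← h1]
  have hKc : K = (univ : Finset (ZMod K)).card := by simp [ZMod.card]
  conv_rhs => rw [hKc]
  rw [← card_product]
  have ha0 := ha p0
  have key : ∀ (z : ZMod K) (m : ℕ), m + a p0 < K → 
      (z + ((m + a p0 : ℕ) : ZMod K) - z).val = m + a p0 := by
    intro z m hm
    rw [add_sub_cancel_left, ZMod.val_natCast_of_lt hm]
  refine Finset.card_bij' 
    (fun c _ => (c p0, fun p => if p = p0 then 0 else (c p - c p0).val - a p0))
    (fun u _ p => if p = p0 then u.1 else u.1 + ((u.2 p + a p0 : ℕ) : ZMod K)) ?_ ?_ ?_ ?_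
  · intro c hc
    rw [mem_circPl] at hc
    simp only [mem_product, mem_univ, true_and, mem_linPl ha, mem_erase, and_true, not_not]
    refine ⟨fun p hp => by simp [hp], fun p hp => ?_, fun p hp q hq hpq => ?_⟩
    · simp only [hp, if_false]
      have h3 := hc p0 p (Ne.symm hp)
      have h4 := hc p p0 hp
      have := ha p
      have h5 := zsub_val (c p - c p0) 0
      rw [zero_sub, neg_sub, ZMod.val_zero] at h5
      omega
    · simp only [hp, hq, if_false]
      have h3 := hc p0 p (Ne.symm hp)
      have h4 := hc p0 q (Ne.symm hq)
      have h5 := hc p q hpq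
      have h6 := hc q p hpq.symm
      have h7 := zsub_val (c p - c p0) (c q - c p0)
      have h8 := zsub_val (c q - c p0) (c p - c p0)
      rw [sub_sub_sub_cancel_right] at h7 h8
      have := ha p
      have := ha q
      have := ZMod.val_lt (c q - c p0)
      have := ZMod.val_lt (c p - c p0)
      have := ZMod.val_lt (c p - c q)
      have := ZMod.val_lt (c q - c p)
      omega
  · rintro ⟨z, u⟩ hu
    simp only [mem_product, mem_univ, true_and, mem_linPl ha, mem_erase, and_true, not_not] at hu
    obtain ⟨h3, h4, h5⟩ := hu
    rw [mem_circPl]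
    intro p q hpq
    have hb : ∀ p, p ≠ p0 → u p + a p0 < K := fun p hp => by
      have := h4 p hp
      have := ha p
      omega
    by_cases hp : p = p0
    · subst hp
      simp only [hpq.symm, if_true, if_false]
      rw [key z _ (hb q hpq.symm)]
      omega
    · by_cases hq : q = p0
      · subst hq
        simp only [hpq, if_true, if_false]
        have h6 := zsub_val (z + ((u p + a q : ℕ) : ZMod K) - z) 0
        rw [zero_sub, neg_sub, ZMod.val_zero, key z _ (hb p hp)] at h6
        have := h4 p hp
        omega
      · simp only [hp, hq, if_false]
        have h6 := zsub_val (z + ((u p + a p0 : ℕ) : ZMod K) - z)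
          (z + ((u q + a p0 : ℕ) : ZMod K) - z)
        rw [sub_sub_sub_cancel_right, key z _ (hb p hp), key z _ (hb q hq)] at h6
        have := h4 p hp
        have := h4 q hq
        have := h5 p hp q hq hpq
        have := ha p
        have := ha q
        omega
  · intro c hc
    rw [mem_circPl] at hc
    funext p
    by_cases hp : p = p0
    · simp [hp]
    · have h3 := hc p0 p (Ne.symm hp)
      simp only [hp, if_false, if_true]
      rw [Nat.sub_add_cancel h3, ZMod.natCast_zmod_val]
      ring
  · rintro ⟨z, u⟩ hu
    simp only [mem_product, mem_univ, true_and, mem_linPl ha, mem_erase, and_true, not_not] at hu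
    obtain ⟨h3, h4, h5⟩ := hu
    simp only [if_true, Prod.mk.injEq, true_and]
    funext p
    by_cases hp : p = p0
    · simp [hp, h3]
    · simp only [hp, if_false]
      rw [key]
      · omega
      · have := h4 p hp
        have := ha p
        omega

/-- points outside all the arcs -/
def freePl (K : ℕ) [NeZero K] (a : ι → ℕ) (c : ι → ZMod K) : Finset (ZMod K) :=
  univ.filter fun y => ∀ p, a p ≤ (y - c p).val

theorem card_arc (K : ℕ) [NeZero K] (m : ℕ) (hm : m ≤ K) (c : ZMod K) :
    (univ.filter fun y : ZMod K => (y - c).val < m).card = m := by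
  conv_rhs => rw [← card_range m]
  refine Finset.card_bij' (fun y _ => (y - c).val) (fun t _ => (t : ZMod K) + c) ?_ ?_ ?_ ?_
  · intro y hy; simpa using hy
  · intro t ht
    simp only [mem_range] at ht
    simp [ZMod.val_natCast_of_lt (lt_of_lt_of_le ht hm), ht]
  · intro y hy; simp
  · intro t ht
    simp only [mem_range] at ht
    simp [ZMod.val_natCast_of_lt (lt_of_lt_of_le ht hm)]

theorem card_freePl {K : ℕ} [NeZero K] {a : ι → ℕ} (haK : ∀ i, a i ≤ K) {c : ι → ZMod K}
    (hc : c ∈ circPl K a) : (freePl K a c).card + ∑ p, a p = K := by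
  rw [mem_circPl] at hc
  have h1 : ∑ p, a p = (univ.biUnion fun p => univ.filter fun y : ZMod K => (y - c p).val < a p).card := by
    rw [card_biUnion]
    · exact sum_congr rfl fun p _ => (card_arc K _ (haK p) _).symm
    · intro p _ q _ hpq
      simp only [Function.onFun]
      rw [Finset.disjoint_left]
      intro y hy hy'
      simp only [mem_filter, mem_univ, true_and] at hy hy'
      have h3 := hc p q hpq
      have h4 := hc q p hpq.symm
      have h5 := zsub_val (y - c q) (y - c p)
      have h6 := zsub_val (y - c p) (y - c q)
      rw [sub_sub_sub_cancel_left] at h5 h6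
      have := ZMod.val_lt (y - c q)
      have := ZMod.val_lt (y - c p)
      have := ZMod.val_lt (c p - c q)
      have := ZMod.val_lt (c q - c p)
      omega
  rw [h1, ← card_union_of_disjoint]
  · have : freePl K a c ∪ (univ.biUnion fun p => univ.filter fun y : ZMod K => (y - c p).val < a p) = univ := by
      ext y
      simp only [freePl, mem_union, mem_filter, mem_univ, true_and, mem_biUnion, iff_true]
      by_contra! h
      obtain ⟨⟨p, h⟩, h'⟩ := h
      have := h' p
      omega
    rw [this, card_univ, ZMod.card]
  · rw [Finset.disjoint_left]
    intro y hy hy'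
    simp only [freePl, mem_filter, mem_univ, true_and, mem_biUnion] at hy hy'
    obtain ⟨p, h⟩ := hy'
    have := hy p
    omega
end Circ

section Fam
variable {Ω : Type*} [DecidableEq Ω] [Fintype Ω]

open Classical in
/-- the bad fibres of a function -/
noncomputable def badFib (K : ℕ) (w : Ω → ℕ) (f : Ω → ZMod K) : Finset (Finset Ω) :=
  univ.filter fun p => p.Nonempty ∧ ∑ x ∈ p, w x ≤ K ∧
    ∃ c, (∀ x ∈ p, f x = c) ∧ ∀ x, x ∉ p → ∑ x ∈ p, w x ≤ (f x - c).val

theorem mem_badFib {K : ℕ} {w : Ω → ℕ} {f : Ω → ZMod K} {p : Finset Ω} :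
    p ∈ badFib K w f ↔ p.Nonempty ∧ ∑ x ∈ p, w x ≤ K ∧
    ∃ c, (∀ x ∈ p, f x = c) ∧ ∀ x, x ∉ p → ∑ x ∈ p, w x ≤ (f x - c).val := by
  simp [badFib]

theorem sumw_pos {w : Ω → ℕ} (hw : ∀ x, 0 < w x) {p : Finset Ω} (hp : p.Nonempty) :
    0 < ∑ x ∈ p, w x := sum_pos (fun x _ => hw x) hp

/-- families of nonempty pairwise disjoint sets -/
def IsFam (P : Finset (Finset Ω)) : Prop := ∅ ∉ P ∧ (P : Set (Finset Ω)).PairwiseDisjoint id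

theorem isFam_of_subset {K : ℕ} {w : Ω → ℕ} (hw : ∀ x, 0 < w x) {f : Ω → ZMod K}
    {P : Finset (Finset Ω)} (h : P ⊆ badFib K w f) : IsFam P := by
  constructor
  · intro h0
    have := (mem_badFib.1 (h h0)).1
    simp at this
  · have key : ∀ p ∈ P, ∀ q ∈ P, ∀ x, x ∈ p → x ∈ q → p ⊆ q := by
      intro p hp q hq x hxp hxq y hy
      obtain ⟨hpn, -, c, h1, h2⟩ := mem_badFib.1 (h hp)
      obtain ⟨hqn, -, c', h1', h2'⟩ := mem_badFib.1 (h hq)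
      by_contra hyq
      have h3 := h2' y hyq
      have : c = c' := by rw [← h1 x hxp, h1' x hxq]
      rw [h1 y hy, this, sub_self, ZMod.val_zero] at h3
      have := sumw_pos hw hqn
      omega
    intro p hp q hq hpq
    simp only [Function.onFun, id]
    rw [Finset.disjoint_left]
    intro x hxp hxq
    exact hpq (Subset.antisymm (key p hp q hq x hxp hxq) (key q hq p hp x hxq hxp))

theorem sum_fam {P : Finset (Finset Ω)} (hP : IsFam P) (w : Ω → ℕ) :
    ∑ p : ↥P, ∑ x ∈ p.1, w x = ∑ x ∈ P.biUnion id, w x := by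
  rw [sum_biUnion hP.2]
  exact sum_coe_sort P fun p => ∑ x ∈ p, w x

theorem card_subset_badFib {K : ℕ} [NeZero K] {w : Ω → ℕ} (hw : ∀ x, 0 < w x)
    (hK : K < ∑ x, w x) {P : Finset (Finset Ω)} (hP : IsFam P) (hne : P.Nonempty) :
    (univ.filter fun f : Ω → ZMod K => P ⊆ badFib K w f).card =
      if ∑ x ∈ P.biUnion id, w x < K then
        K * (K - (∑ x ∈ P.biUnion id, w x) + 1).ascFactorial (P.card - 1) *
          (K - ∑ x ∈ P.biUnion id, w x) ^ (Fintype.card Ω - (P.biUnion id).card)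
      else 0 := by
  classical
  set a : ↥P → ℕ := fun p => ∑ x ∈ p.1, w x with ha_def
  have hpn : ∀ p : ↥P, p.1.Nonempty := fun p => by
    rw [nonempty_iff_ne_empty]
    intro h
    exact hP.1 (h ▸ p.2)
  have hdis : ∀ p q : ↥P, ∀ x, x ∈ p.1 → x ∈ q.1 → p = q := by
    intro p q x hp hq
    by_contra hne
    have := hP.2 p.2 q.2 (fun h => hne (Subtype.ext h))
    exact (Finset.disjoint_left.1 this) hp hq
  have ha : ∀ p, 0 < a p := fun p => sumw_pos hw (hpn p)
  have hsum : ∑ p, a p = ∑ x ∈ P.biUnion id, w x := sum_fam hP w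
  let t : (↥P → ZMod K) → Ω → Finset (ZMod K) := fun c x =>
    univ.filter fun y => ∀ p : ↥P, if x ∈ p.1 then y = c p else a p ≤ (y - c p).val
  have hmt : ∀ c f, f ∈ Fintype.piFinset (t c) ↔ ∀ x, ∀ p : ↥P, if x ∈ p.1 then f x = c p else a p ≤ (f x - c p).val := by
    intro c f
    simp [t, Fintype.mem_piFinset]
  have hcirc : ∀ c f, f ∈ Fintype.piFinset (t c) → c ∈ circPl K a := by
    intro c f hf
    rw [hmt] at hf
    rw [mem_circPl]
    intro p q hpq
    obtain ⟨x, hx⟩ := hpn q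
    have h1 := hf x q
    have h2 := hf x p
    have hxp : x ∉ p.1 := fun h => hpq (hdis p q x h hx)
    rw [if_pos hx] at h1
    rw [if_neg hxp, h1] at h2
    exact h2
  have hex : ∀ f : Ω → ZMod K, P ⊆ badFib K w f ↔ (∀ p, a p ≤ K) ∧ ∃ c, f ∈ Fintype.piFinset (t c) := by
    intro f
    constructor
    · intro h
      refine ⟨fun p => (mem_badFib.1 (h p.2)).2.1, ?_⟩
      have h' : ∀ p : ↥P, ∃ c, (∀ x ∈ p.1, f x = c) ∧ ∀ x, x ∉ p.1 → ∑ x ∈ p.1, w x ≤ (f x - c).val :=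
        fun p => (mem_badFib.1 (h p.2)).2.2
      choose c hc using h'
      refine ⟨c, (hmt _ _).2 fun x p => ?_⟩
      split_ifs with hx
      · exact (hc p).1 x hx
      · exact (hc p).2 x hx
    · rintro ⟨h1, c, hc⟩ p hp
      rw [hmt] at hc
      refine mem_badFib.2 ⟨hpn ⟨p, hp⟩, h1 ⟨p, hp⟩, c ⟨p, hp⟩, fun x hx => ?_, fun x hx => ?_⟩
      · have := hc x ⟨p, hp⟩
        rwa [if_pos hx] at this
      · have := hc x ⟨p, hp⟩
        rwa [if_neg hx] at this
  by_cases hle : ∑ x ∈ P.biUnion id, w x ≤ K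
  swap
  · rw [if_neg (by omega), card_eq_zero, eq_empty_iff_forall_notMem]
    intro f hf
    simp only [mem_filter, mem_univ, true_and] at hf
    rw [hex] at hf
    obtain ⟨h1, c, hc⟩ := hf
    have := card_freePl h1 (hcirc c f hc)
    omega
  have haK : ∀ p, a p ≤ K := fun p => by
    have := single_le_sum (f := a) (fun _ _ => Nat.zero_le _) (mem_univ p)
    omega
  have hJ : (P.biUnion id).card < Fintype.card Ω := by
    rw [card_lt_iff_ne_univ]
    intro h
    rw [h] at hle
    omega
  have hfil : (univ.filter fun f : Ω → ZMod K => P ⊆ badFib K w f) =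
      (circPl K a).biUnion fun c => Fintype.piFinset (t c) := by
    ext f
    simp only [mem_filter, mem_univ, true_and, mem_biUnion]
    rw [hex]
    constructor
    · rintro ⟨-, c, hc⟩
      exact ⟨c, hcirc c f hc, hc⟩
    · rintro ⟨c, -, hc⟩
      exact ⟨haK, c, hc⟩
  rw [hfil, card_biUnion]
  swap
  · intro c hc c' hc' hne
    simp only [Function.onFun]
    rw [Finset.disjoint_left]
    intro f hf hf'
    rw [hmt] at hf hf'
    apply hne
    funext p
    obtain ⟨x, hx⟩ := hpn p
    have h1 := hf x p
    have h2 := hf' x p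
    rw [if_pos hx] at h1 h2
    rw [← h1, h2]
  have hcount : ∀ c ∈ circPl K a, (Fintype.piFinset (t c)).card =
      (K - ∑ x ∈ P.biUnion id, w x) ^ (Fintype.card Ω - (P.biUnion id).card) := by
    intro c hc
    have hfr := card_freePl haK hc
    rw [Fintype.card_piFinset]
    have : ∀ x, (t c x).card = if x ∈ P.biUnion id then 1 else K - ∑ x ∈ P.biUnion id, w x := by
      intro x
      split_ifs with hx
      · simp only [mem_biUnion, id] at hx
        obtain ⟨p, hp, hx⟩ := hx
        rw [card_eq_one]
        refine ⟨c ⟨p, hp⟩, ?_⟩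
        ext y
        simp only [t, mem_filter, mem_univ, true_and, mem_singleton]
        constructor
        · intro h
          have := h ⟨p, hp⟩
          rwa [if_pos hx] at this
        · rintro rfl q
          split_ifs with hq
          · rw [hdis ⟨p, hp⟩ q x hx hq]
          · rw [mem_circPl] at hc
            apply hc
            rintro rfl
            exact hq hx
      · have h1 : t c x = freePl K a c := by
          ext y
          simp only [t, freePl, mem_filter, mem_univ, true_and]
          refine forall_congr' fun p => ?_
          rw [if_neg]
          intro h
          exact hx (mem_biUnion.2 ⟨p.1, p.2, h⟩)
        rw [h1]
        omega
    rw [prod_congr rfl fun x _ => this x, prod_ite, prod_const_one, one_mul, prod_const]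
    congr 1
    have : (univ.filter fun x => x ∉ P.biUnion id) = (P.biUnion id)ᶜ := by ext; simp
    rw [this, card_compl]
  rw [sum_congr rfl hcount, sum_const, smul_eq_mul]
  split_ifs with hlt
  · obtain ⟨p0, hp0⟩ := hne
    rw [card_circPl K a ha ⟨p0, hp0⟩ (by omega), hsum, Fintype.card_coe]
  · have : K - ∑ x ∈ P.biUnion id, w x = 0 := by omega
    rw [this, zero_pow (by omega), mul_zero]

theorem sum_powerset_nonempty {α : Type*} [DecidableEq α] (B : Finset α) :
    ∑ P ∈ B.powerset.filter (fun P => P.Nonempty), (-1 : ℚ) ^ (P.card + 1) =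
      if B.Nonempty then 1 else 0 := by
  have h := Finset.sum_powerset_neg_one_pow_card (x := B)
  have h1 : (B.powerset.filter fun P => P.Nonempty) = B.powerset.erase ∅ := by
    ext P
    simp [nonempty_iff_ne_empty, and_comm]
  have h2 := add_sum_erase B.powerset (fun P => (-1 : ℚ) ^ (P.card + 1)) (empty_mem_powerset B)
  have h3 : ∑ P ∈ B.powerset, (-1 : ℚ) ^ (P.card + 1) = - (if B = ∅ then 1 else 0) := by
    have : ((∑ m ∈ B.powerset, (-1 : ℤ) ^ m.card : ℤ) : ℚ) = ((if B = ∅ then 1 else 0 : ℤ) : ℚ) := by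
      rw [h]
    push_cast at this
    rw [← this, ← sum_neg_distrib]
    exact sum_congr rfl fun P _ => by ring
  rw [h1]
  simp only [card_empty, zero_add, pow_one] at h2
  rcases B.eq_empty_or_nonempty with hB | hB
  · subst hB; simp
  · rw [if_pos hB]
    rw [if_neg hB.ne_empty] at h3
    linarith

open Classical in
theorem card_bad {K : ℕ} [NeZero K] {w : Ω → ℕ} (hw : ∀ x, 0 < w x) (hK : K < ∑ x, w x) :
    ((univ.filter fun f : Ω → ZMod K => (badFib K w f).Nonempty).card : ℚ) =
      ∑ P ∈ univ.filter (fun P : Finset (Finset Ω) => IsFam P ∧ P.Nonempty ∧ ∑ x ∈ P.biUnion id, w x < K),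
        (-1 : ℚ) ^ (P.card + 1) * (K * (∏ b ∈ Icc 1 (P.card - 1), ((K : ℚ) - ∑ x ∈ P.biUnion id, (w x : ℚ) + b)) *
          ((K : ℚ) - ∑ x ∈ P.biUnion id, (w x : ℚ)) ^ (Fintype.card Ω - (P.biUnion id).card)) := by
  have h1 : ((univ.filter fun f : Ω → ZMod K => (badFib K w f).Nonempty).card : ℚ) =
      ∑ f : Ω → ZMod K, ∑ P : Finset (Finset Ω), if P.Nonempty ∧ P ⊆ badFib K w f then (-1 : ℚ) ^ (P.card + 1) else 0 := by
    rw [card_filter]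
    push_cast
    refine sum_congr rfl fun f _ => ?_
    rw [← sum_powerset_nonempty, ← sum_filter]
    refine sum_congr ?_ fun _ _ => rfl
    ext P
    simp [and_comm]
  rw [h1, sum_comm, sum_filter]
  refine sum_congr rfl fun P _ => ?_
  by_cases hne : P.Nonempty
  swap
  · simp [hne]
  by_cases hP : IsFam P
  swap
  · rw [if_neg (by tauto)]
    refine sum_eq_zero fun f _ => ?_
    rw [if_neg]
    rintro ⟨-, h⟩
    exact hP (isFam_of_subset hw h)
  simp only [hne, hP, true_and]
  rw [← sum_filter, sum_const, card_subset_badFib hw hK hP hne]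
  split_ifs with hlt
  swap
  · simp
  rw [nsmul_eq_mul, mul_comm]
  congr 1
  have hc : (((K - ∑ x ∈ P.biUnion id, w x : ℕ)) : ℚ) = (K : ℚ) - ∑ x ∈ P.biUnion id, (w x : ℚ) := by
    rw [Nat.cast_sub hlt.le]; push_cast; rfl
  have hasc : ∀ m h : ℕ, ((m + 1).ascFactorial h : ℚ) = ∏ b ∈ Icc 1 h, ((m : ℚ) + b) := by
    intro m h
    induction h with
    | zero => simp
    | succ h ih =>
      rw [Nat.ascFactorial_succ, prod_Icc_succ_top (by omega), ← ih]
      push_cast; ring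
  push_cast
  rw [hasc, hc]
end Fam

section Grp
variable {Ω : Type*} [DecidableEq Ω] [Fintype Ω]

open Classical in
theorem card_fam_eq_stirling2 (J : Finset Ω) (h : ℕ) :
    (univ.filter fun P : Finset (Finset Ω) => IsFam P ∧ P.biUnion id = J ∧ P.card = h).card =
      stirling2 J.card h := by
  let e : Fin J.card ↪ Ω := J.equivFin.symm.toEmbedding.trans (Function.Embedding.subtype _)
  have he : ∀ x, x ∈ J ↔ ∃ i, e i = x := by
    intro x
    constructor
    · intro hx
      exact ⟨J.equivFin ⟨x, hx⟩, by simp [e]⟩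
    · rintro ⟨i, rfl⟩
      simp [e]
  let Φ : Finpartition (univ : Finset (Fin J.card)) → Finset (Finset Ω) := fun Q =>
    Q.parts.map (mapEmbedding e).toEmbedding
  have hinj : Function.Injective Φ := by
    intro Q Q' hQ
    exact Finpartition.ext (map_injective _ hQ)
  rw [stirling2, ← Set.ncard_image_of_injective _ hinj, ← Set.ncard_coe_finset]
  congr 1
  ext P
  simp only [coe_filter, mem_univ, true_and, Set.mem_ofPred_eq, Set.mem_image]
  constructor
  · rintro ⟨⟨h0, hd⟩, hU, hc⟩
    have hsub : ∀ p ∈ P, ∃ A : Finset (Fin J.card), A.map e = p := by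
      intro p hp
      refine ⟨univ.filter fun i => e i ∈ p, ?_⟩
      ext x
      simp only [mem_map, mem_filter, mem_univ, true_and]
      constructor
      · rintro ⟨i, hi, rfl⟩; exact hi
      · intro hx
        have hxJ : x ∈ J := by
          rw [← hU]; exact mem_biUnion.2 ⟨p, hp, hx⟩
        obtain ⟨i, rfl⟩ := (he x).1 hxJ
        exact ⟨i, hx, rfl⟩
    let parts : Finset (Finset (Fin J.card)) := univ.filter fun A => A.map e ∈ P
    have hmap : parts.map (mapEmbedding e).toEmbedding = P := by
      ext p
      simp only [parts, mem_map, mem_filter, mem_univ, true_and]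
      constructor
      · rintro ⟨A, hA, rfl⟩; exact hA
      · intro hp
        obtain ⟨A, rfl⟩ := hsub p hp
        exact ⟨A, hp, rfl⟩
    refine ⟨⟨parts, ?_, ?_, ?_⟩, ?_, hmap⟩
    · rw [supIndep_iff_pairwiseDisjoint]
      intro A hA B hB hAB
      simp only [parts, coe_filter, mem_univ, true_and, Set.mem_ofPred_eq] at hA hB
      have := hd hA hB (fun h => hAB (map_injective e h))
      simp only [Function.onFun, id] at this ⊢
      exact (disjoint_map e).1 this
    · ext i
      simp only [mem_univ, iff_true, mem_sup, id]
      have : e i ∈ P.biUnion id := by rw [hU]; exact (he _).2 ⟨i, rfl⟩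
      obtain ⟨p, hp, hi⟩ := mem_biUnion.1 this
      obtain ⟨A, rfl⟩ := hsub p hp
      exact ⟨A, by simp [parts, hp], by simpa using hi⟩
    · simp [parts, h0]
    · show parts.card = h
      rw [← hc, ← hmap, card_map]
  · rintro ⟨Q, hQ, rfl⟩
    refine ⟨⟨?_, ?_⟩, ?_, ?_⟩
    · simp only [Φ, mem_map, not_exists, not_and]
      intro A hA h
      have hA' : A = ∅ := by simpa using h
      exact Q.ne_empty hA hA'
    · intro p hp q hq hpq
      simp only [Φ, coe_map, Set.mem_image, mem_coe] at hp hq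
      obtain ⟨A, hA, rfl⟩ := hp
      obtain ⟨B, hB, rfl⟩ := hq
      have := Q.disjoint hA hB (fun h => hpq (by rw [h]))
      simp only [Function.onFun, id] at this ⊢
      exact (disjoint_map e).2 this
    · ext x
      simp only [Φ, mem_biUnion, mem_map, id, he]
      constructor
      · rintro ⟨_, ⟨A, hA, rfl⟩, hx⟩
        obtain ⟨i, -, hi⟩ := mem_map.1 hx
        exact ⟨i, hi⟩
      · rintro ⟨i, rfl⟩
        obtain ⟨A, hA, hi⟩ := Q.exists_mem (mem_univ i)
        exact ⟨_, ⟨A, hA, rfl⟩, mem_map.2 ⟨i, hi, rfl⟩⟩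
    · simp [Φ, hQ]

open Classical in
theorem card_fam_group (s : Ω → ℕ) (h i j : ℕ) :
    (univ.filter fun P : Finset (Finset Ω) => IsFam P ∧ P.card = h ∧
        ∑ x ∈ P.biUnion id, s x = i ∧ (P.biUnion id).card = j).card =
      (univ.filter fun J : Finset Ω => ∑ x ∈ J, s x = i ∧ J.card = j).card * stirling2 j h := by
  rw [card_eq_sum_card_fiberwise (f := fun P => P.biUnion id)
    (t := univ.filter fun J : Finset Ω => ∑ x ∈ J, s x = i ∧ J.card = j)]
  · rw [← smul_eq_mul, ← sum_const]
    refine sum_congr rfl fun J hJ => ?_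
    simp only [mem_filter, mem_univ, true_and] at hJ
    rw [← hJ.2, ← card_fam_eq_stirling2 J h, filter_filter]
    congr 1
    ext P
    simp only [mem_filter, mem_univ, true_and]
    constructor
    · rintro ⟨⟨a, b, c, d⟩, e⟩; exact ⟨a, e, b⟩
    · rintro ⟨a, e, b⟩
      exact ⟨⟨a, b, by rw [e, hJ.1], by rw [e]⟩, e⟩
  · intro P hP
    simp only [coe_filter, mem_univ, true_and, Set.mem_ofPred_eq] at hP ⊢
    exact hP.2.2

theorem fam_card_le {P : Finset (Finset Ω)} (hP : IsFam P) : P.card ≤ (P.biUnion id).card := by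
  rw [card_biUnion hP.2, card_eq_sum_ones]
  refine sum_le_sum fun p hp => ?_
  have : p ≠ ∅ := fun h => hP.1 (h ▸ hp)
  exact card_pos.2 (nonempty_iff_ne_empty.2 this)

open Classical in
theorem sum_fam_group {s : Ω → ℕ} (hs : ∀ x, 0 < s x) (k : ℕ) (G : ℕ → ℕ → ℕ → ℚ) :
    ∑ P ∈ univ.filter (fun P : Finset (Finset Ω) => IsFam P ∧ P.Nonempty ∧ ∑ x ∈ P.biUnion id, s x < k),
        (-1 : ℚ) ^ (P.card + 1) * G P.card (∑ x ∈ P.biUnion id, s x) (P.biUnion id).card =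
      ∑ h ∈ Icc 1 (k-1), (-1 : ℚ) ^ (h+1) * ∑ i ∈ Icc h (k-1), ∑ j ∈ Icc 1 i,
        G h i j * ((univ.filter fun J : Finset Ω => ∑ x ∈ J, s x = i ∧ J.card = j).card : ℚ)
          * (stirling2 j h : ℚ) := by
  have hb : ∀ P : Finset (Finset Ω), IsFam P → P.Nonempty → 1 ≤ P.card ∧ P.card ≤ (P.biUnion id).card ∧
      (P.biUnion id).card ≤ ∑ x ∈ P.biUnion id, s x := by
    intro P hP hne
    refine ⟨card_pos.2 hne, fam_card_le hP, ?_⟩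
    rw [card_eq_sum_ones]
    exact sum_le_sum fun x _ => hs x
  rw [← sum_fiberwise_of_maps_to (g := fun P => P.card) (t := Icc 1 (k-1))]
  swap
  · intro P hP
    simp only [mem_filter, mem_univ, true_and] at hP
    have := hb P hP.1 hP.2.1
    simp only [mem_Icc]; omega
  refine sum_congr rfl fun h hh => ?_
  rw [mem_Icc] at hh
  rw [filter_filter, ← sum_fiberwise_of_maps_to (g := fun P => ∑ x ∈ P.biUnion id, s x) (t := Icc h (k-1)), mul_sum]
  swap
  · intro P hP
    simp only [mem_filter, mem_univ, true_and] at hP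
    have := hb P hP.1.1 hP.1.2.1
    simp only [mem_Icc]; omega
  refine sum_congr rfl fun i hi => ?_
  rw [mem_Icc] at hi
  rw [filter_filter, ← sum_fiberwise_of_maps_to (g := fun P => (P.biUnion id).card) (t := Icc 1 i), mul_sum]
  swap
  · intro P hP
    simp only [mem_filter, mem_univ, true_and] at hP
    have := hb P hP.1.1.1 hP.1.1.2.1
    simp only [mem_Icc]; omega
  refine sum_congr rfl fun j hj => ?_
  rw [filter_filter]
  have h1 : (univ.filter fun P : Finset (Finset Ω) => (((IsFam P ∧ P.Nonempty ∧ ∑ x ∈ P.biUnion id, s x < k) ∧ P.card = h) ∧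
      ∑ x ∈ P.biUnion id, s x = i) ∧ (P.biUnion id).card = j) = univ.filter fun P : Finset (Finset Ω) => IsFam P ∧ P.card = h ∧
        ∑ x ∈ P.biUnion id, s x = i ∧ (P.biUnion id).card = j := by
    ext P
    simp only [mem_filter, mem_univ, true_and]
    constructor
    · tauto
    · rintro ⟨a, b, c, d⟩
      refine ⟨⟨⟨⟨a, ?_, by omega⟩, b⟩, c⟩, d⟩
      rw [← card_pos]; omega
  rw [h1, sum_congr rfl (g := fun _ => (-1 : ℚ) ^ (h+1) * G h i j), sum_const, card_fam_group, nsmul_eq_mul]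
  · push_cast; ring
  · intro P hP
    simp only [mem_filter, mem_univ, true_and] at hP
    obtain ⟨a, b, c, d⟩ := hP
    rw [b, c, d]

theorem card_subsets_type (s : Ω → ℕ) (hs : ∀ x, 0 < s x) (k i j : ℕ) (hi : i < k) :
    (univ.filter fun J : Finset Ω => ∑ x ∈ J, s x = i ∧ J.card = j).card =
      ∑ I ∈ (Iset k i).filter (fun I => ∑ t, I t = j),
        ∏ t : Fin (k-1), Nat.choose (univ.filter fun x => s x = (t : ℕ) + 1).card (I t) := by
  have hlt : ∀ J : Finset Ω, ∑ x ∈ J, s x = i → ∀ x ∈ J, s x - 1 < k - 1 := by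
    intro J hJ x hx
    have := single_le_sum (f := s) (fun _ _ => Nat.zero_le _) hx
    have := hs x
    omega
  have hcard : ∀ J : Finset Ω, (∀ x ∈ J, s x - 1 < k - 1) →
      J.card = ∑ t : Fin (k-1), (J.filter fun x => s x = (t:ℕ)+1).card := by
    intro J hJ
    have : J = univ.biUnion fun t : Fin (k-1) => J.filter fun x => s x = (t:ℕ)+1 := by
      ext x
      simp only [mem_biUnion, mem_univ, true_and, mem_filter]
      constructor
      · intro hx
        exact ⟨⟨s x - 1, hJ x hx⟩, hx, by have := hs x; simp; omega⟩
      · rintro ⟨t, h, -⟩; exact h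
    conv_lhs => rw [this]
    rw [card_biUnion]
    intro t _ t' _ hne
    simp only [Function.onFun]
    rw [Finset.disjoint_left]
    intro x hx hx'
    simp only [mem_filter] at hx hx'
    exact hne (Fin.ext (by omega))
  have hsum : ∀ J : Finset Ω, (∀ x ∈ J, s x - 1 < k - 1) →
      ∑ x ∈ J, s x = ∑ t : Fin (k-1), ((t:ℕ)+1) * (J.filter fun x => s x = (t:ℕ)+1).card := by
    intro J hJ
    have : J = univ.biUnion fun t : Fin (k-1) => J.filter fun x => s x = (t:ℕ)+1 := by
      ext x
      simp only [mem_biUnion, mem_univ, true_and, mem_filter]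
      constructor
      · intro hx
        exact ⟨⟨s x - 1, hJ x hx⟩, hx, by have := hs x; simp; omega⟩
      · rintro ⟨t, h, -⟩; exact h
    conv_lhs => rw [this]
    rw [sum_biUnion]
    · refine sum_congr rfl fun t _ => ?_
      rw [sum_congr rfl (g := fun _ => (t:ℕ)+1), sum_const, smul_eq_mul, mul_comm]
      intro x hx
      exact (mem_filter.1 hx).2
    intro t _ t' _ hne
    simp only [Function.onFun]
    rw [Finset.disjoint_left]
    intro x hx hx'
    simp only [mem_filter] at hx hx'
    exact hne (Fin.ext (by omega))
  have hmem : ∀ I : Fin (k-1) → ℕ, I ∈ Iset k i ↔ ∑ t : Fin (k-1), ((t:ℕ)+1) * I t = i := by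
    intro I
    simp only [Iset, mem_image, mem_filter, mem_univ, true_and]
    constructor
    · rintro ⟨I', h, rfl⟩; exact h
    · intro h
      refine ⟨fun t => ⟨I t, ?_⟩, h, rfl⟩
      have := single_le_sum (f := fun t : Fin (k-1) => ((t:ℕ)+1) * I t) (fun _ _ => Nat.zero_le _) (mem_univ t)
      nlinarith
  rw [card_eq_sum_card_fiberwise (f := fun J t => (J.filter fun x => s x = (t:ℕ)+1).card)
    (t := (Iset k i).filter (fun I => ∑ t, I t = j))]
  swap
  · intro J hJ
    simp only [coe_filter, mem_univ, true_and, Set.mem_ofPred_eq, hmem] at hJ ⊢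
    have := hlt J hJ.1
    exact ⟨by rw [← hsum J this, hJ.1], by rw [← hcard J this, hJ.2]⟩
  refine sum_congr rfl fun I hI => ?_
  simp only [mem_filter, hmem] at hI
  rw [← prod_congr rfl fun t _ => card_powersetCard (I t) _, ← Fintype.card_piFinset]
  refine Finset.card_bij' (fun J _ t => J.filter fun x => s x = (t:ℕ)+1)
    (fun A _ => univ.biUnion A) ?_ ?_ ?_ ?_
  · intro J hJ
    simp only [mem_filter, mem_univ, true_and] at hJ
    rw [Fintype.mem_piFinset]
    intro t
    rw [mem_powersetCard]
    exact ⟨filter_subset_filter _ (subset_univ _), congrFun hJ.2 t⟩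
  · intro A hA
    rw [Fintype.mem_piFinset] at hA
    simp only [mem_powersetCard] at hA
    have hAs : ∀ t, ∀ x ∈ A t, s x = (t:ℕ)+1 := fun t x hx => by
      simpa using (hA t).1 hx
    have hf : ∀ t : Fin (k-1), ((univ.biUnion A).filter fun x => s x = (t:ℕ)+1) = A t := by
      intro t
      ext x
      simp only [mem_filter, mem_biUnion, mem_univ, true_and]
      constructor
      · rintro ⟨⟨t', h⟩, h'⟩
        have := hAs t' x h
        have : t' = t := Fin.ext (by omega)
        exact this ▸ h
      · intro h; exact ⟨⟨t, h⟩, hAs t x h⟩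
    have hl : ∀ x ∈ univ.biUnion A, s x - 1 < k - 1 := by
      intro x hx
      simp only [mem_biUnion, mem_univ, true_and] at hx
      obtain ⟨t, h⟩ := hx
      have := hAs t x h
      have := t.2
      omega
    simp only [mem_filter, mem_univ, true_and]
    have hfc : ∀ t : Fin (k-1), ((univ.biUnion A).filter fun x => s x = (t:ℕ)+1).card = I t := by
      intro t; rw [hf t, (hA t).2]
    refine ⟨⟨?_, ?_⟩, funext hfc⟩
    · rw [hsum _ hl, ← hI.1]
      exact sum_congr rfl fun t _ => by rw [hfc]
    · rw [hcard _ hl, ← hI.2]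
      exact sum_congr rfl fun t _ => by rw [hfc]
  · intro J hJ
    simp only [mem_filter, mem_univ, true_and] at hJ
    ext x
    simp only [mem_biUnion, mem_univ, true_and, mem_filter]
    constructor
    · rintro ⟨t, h, -⟩; exact h
    · intro hx
      exact ⟨⟨s x - 1, hlt J hJ.1.1 x hx⟩, hx, by have := hs x; simp; omega⟩
  · intro A hA
    rw [Fintype.mem_piFinset] at hA
    simp only [mem_powersetCard] at hA
    have hAs : ∀ t, ∀ x ∈ A t, s x = (t:ℕ)+1 := fun t x hx => by
      simpa using (hA t).1 hx
    funext t
    ext x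
    simp only [mem_filter, mem_biUnion, mem_univ, true_and]
    constructor
    · rintro ⟨⟨t', h⟩, h'⟩
      have := hAs t' x h
      have : t' = t := Fin.ext (by omega)
      exact this ▸ h
    · intro h; exact ⟨⟨t, h⟩, hAs t x h⟩
end Grp

section Per
variable {n : ℕ} (σ : Equiv.Perm (Fin n))

/-- the cycle of a point -/
def cyc (x : Fin n) : ↥(cycleSets σ) :=
  ⟨univ.filter fun y => σ.SameCycle x y, mem_image.2 ⟨x, mem_univ _, rfl⟩⟩

theorem cyc_eq_iff (x y : Fin n) : cyc σ x = cyc σ y ↔ σ.SameCycle x y := by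
  rw [Subtype.ext_iff]
  show (univ.filter fun z => σ.SameCycle x z) = (univ.filter fun z => σ.SameCycle y z) ↔ _
  constructor
  · intro h
    have : y ∈ univ.filter fun z => σ.SameCycle y z := by
      simp [Equiv.Perm.SameCycle.refl]
    rw [← h] at this
    simpa using this
  · intro h
    ext z
    simp only [mem_filter, mem_univ, true_and]
    exact ⟨fun h' => h.symm.trans h', fun h' => h.trans h'⟩

theorem cyc_surj (C : ↥(cycleSets σ)) : ∃ x, cyc σ x = C := by
  obtain ⟨x, -, hx⟩ := mem_image.1 C.2
  exact ⟨x, Subtype.ext hx⟩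

theorem cyc_fiber (C : ↥(cycleSets σ)) : (univ.filter fun x => cyc σ x = C) = C.1 := by
  obtain ⟨x, rfl⟩ := cyc_surj σ C
  ext y
  simp only [mem_filter, mem_univ, true_and]
  rw [eq_comm, cyc_eq_iff]
  simp [cyc]

theorem cyc_card_pos (C : ↥(cycleSets σ)) : 0 < C.1.card := by
  obtain ⟨x, hx⟩ := cyc_surj σ C
  rw [← cyc_fiber, card_pos]
  exact ⟨x, by simpa using hx⟩

theorem zpow_fix_iff (x : Fin n) (m : ℤ) : (σ ^ m) x = x ↔ ((cyc σ x).1.card : ℤ) ∣ m := by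
  classical
  have h1 := MulAction.zpow_smul_eq_iff_minimalPeriod_dvd (a := σ) (b := x) (n := m)
  have h2 : Function.minimalPeriod (σ • ·) x = (cyc σ x).1.card := by
    rw [MulAction.minimalPeriod_eq_card, ← Set.toFinset_card]
    congr 1
    ext y
    simp only [Set.mem_toFinset, cyc, mem_filter, mem_univ, true_and, MulAction.mem_orbit_iff]
    constructor
    · rintro ⟨⟨g, i, rfl⟩, h⟩
      exact ⟨i, h⟩
    · rintro ⟨i, h⟩
      exact ⟨⟨σ ^ i, i, rfl⟩, h⟩
  rw [h2] at h1
  exact h1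

theorem sum_cyc (s : ↥(cycleSets σ) → Prop) [DecidablePred s] :
    (univ.filter fun x => s (cyc σ x)).card = ∑ C ∈ univ.filter s, C.1.card := by
  rw [card_eq_sum_card_fiberwise (f := cyc σ) (t := univ.filter s)]
  · refine sum_congr rfl fun C hC => ?_
    simp only [mem_filter, mem_univ, true_and] at hC
    rw [← cyc_fiber σ C, filter_filter]
    congr 1
    ext x
    simp only [mem_filter, mem_univ, true_and, and_iff_right_iff_imp]
    rintro rfl; exact hC
  · intro x hx
    simpa using hx

variable {k : ℕ} {σ}

theorem turn_zpow {f : Fin n → ZMod k} {τ : ZMod k} (hf : ∀ x, f (σ⁻¹ x) = f x + τ) (m : ℤ) (x : Fin n) :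
    f ((σ ^ m) x) = f x - m • τ := by
  have h1 : ∀ x, f (σ x) = f x - τ := by
    intro x
    have := hf (σ x)
    rw [show σ⁻¹ (σ x) = x by simp] at this
    rw [this]; ring
  induction m using Int.induction_on generalizing x with
  | zero => simp
  | succ i ih =>
    rw [zpow_add, zpow_one, Equiv.Perm.mul_apply, ih, h1, add_smul, one_smul]; ring
  | pred i ih =>
    rw [zpow_sub, zpow_one, Equiv.Perm.mul_apply, ih, hf, sub_smul, one_smul]; ring

theorem turn_dvd {f : Fin n → ZMod k} {τ : ZMod k} (hf : ∀ x, f (σ⁻¹ x) = f x + τ)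
    (C : ↥(cycleSets σ)) : addOrderOf τ ∣ C.1.card := by
  obtain ⟨x, rfl⟩ := cyc_surj σ C
  have h1 := (zpow_fix_iff σ x (cyc σ x).1.card).2 dvd_rfl
  have h2 := turn_zpow hf (cyc σ x).1.card x
  rw [h1] at h2
  apply addOrderOf_dvd_of_nsmul_eq_zero
  rw [← natCast_zsmul]
  exact (sub_eq_self.1 h2.symm)

section Quot
variable [NeZero k] (τ : ZMod k)

theorem ord_dvd : addOrderOf τ ∣ k := by
  apply addOrderOf_dvd_of_nsmul_eq_zero
  simp

theorem ord_pos : 0 < addOrderOf τ := Nat.pos_of_dvd_of_pos (ord_dvd τ) (NeZero.pos k)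

/-- the quotient modulus -/
noncomputable def qK {k : ℕ} [NeZero k] (τ : ZMod k) : ℕ := k / addOrderOf τ

theorem qK_mul : addOrderOf τ * qK τ = k := Nat.mul_div_cancel' (ord_dvd τ)

theorem qK_dvd : qK τ ∣ k := ⟨_, by rw [mul_comm]; exact (qK_mul τ).symm⟩

instance qK_ne : NeZero (qK τ) := ⟨by
  intro h
  have := qK_mul τ
  rw [h, mul_zero] at this
  exact NeZero.ne k this.symm⟩

/-- the quotient map -/
noncomputable def qpi {k : ℕ} [NeZero k] (τ : ZMod k) : ZMod k →+* ZMod (qK τ) := ZMod.castHom (qK_dvd τ) _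

theorem qpi_tau : qpi τ τ = 0 := by
  have h1 : addOrderOf τ • τ = 0 := addOrderOf_nsmul_eq_zero τ
  have h2 : k ∣ addOrderOf τ * τ.val := by
    rw [← ZMod.natCast_eq_zero_iff]
    push_cast
    rw [ZMod.natCast_zmod_val, ← nsmul_eq_mul, h1]
  have h3 : qK τ ∣ τ.val := by
    rw [← Nat.mul_dvd_mul_iff_left (ord_pos τ), qK_mul]
    exact h2
  rw [← ZMod.natCast_zmod_val τ, map_natCast, ZMod.natCast_zmod_val, ZMod.natCast_eq_zero_iff]
  exact h3

theorem qpi_surj (q : ZMod (qK τ)) : ∃ y, qpi τ y = q := ZMod.castHom_surjective (qK_dvd τ) q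

theorem qpi_fiber (q : ZMod (qK τ)) : (univ.filter fun y => qpi τ y = q).card = addOrderOf τ := by
  have h1 : ∀ q, (univ.filter fun y => qpi τ y = q).card = (univ.filter fun y => qpi τ y = 0).card := by
    intro q
    obtain ⟨z, rfl⟩ := qpi_surj τ q
    refine Finset.card_bij' (fun y _ => y - z) (fun y _ => y + z) ?_ ?_ ?_ ?_
    · intro y hy
      simp only [mem_filter, mem_univ, true_and] at hy ⊢
      rw [map_sub, hy, sub_self]
    · intro y hy
      simp only [mem_filter, mem_univ, true_and] at hy ⊢
      rw [map_add, hy, zero_add]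
    · intro y _; simp
    · intro y _; simp
  have h2 := card_eq_sum_card_fiberwise (f := qpi τ) (s := univ) (t := univ) (fun _ _ => mem_coe.2 (mem_univ _))
  rw [sum_congr rfl fun q _ => h1 q, sum_const, smul_eq_mul, card_univ, card_univ, ZMod.card, ZMod.card] at h2
  have h3 := qK_mul τ
  have h4 := NeZero.pos (qK τ)
  rw [h1]
  have : qK τ * (univ.filter fun y => qpi τ y = 0).card = qK τ * addOrderOf τ := by
    rw [← h2, mul_comm, h3]
  exact Nat.eq_of_mul_eq_mul_left h4 this

theorem qpi_ker_eq : (univ.filter fun y => qpi τ y = 0) = (range (addOrderOf τ)).image fun m => m • τ := by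
  symm
  apply eq_of_subset_of_card_le
  · intro y hy
    obtain ⟨m, -, rfl⟩ := mem_image.1 hy
    simp [qpi_tau]
  · rw [qpi_fiber, card_image_of_injOn, card_range]
    intro a ha b hb hab
    simp only [coe_range, Set.mem_Iio] at ha hb
    exact nsmul_injOn_Iio_addOrderOf ha hb hab

variable {τ}

theorem occ_lift {f : Fin n → ZMod k} (hf : ∀ x, f (σ⁻¹ x) = f x + τ) {y : ZMod k} {x : Fin n}
    (h : qpi τ y = qpi τ (f x)) : ∃ x', f x' = y := by
  have : y - f x ∈ univ.filter fun y => qpi τ y = 0 := by simp [h]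
  rw [qpi_ker_eq] at this
  obtain ⟨m, -, hm⟩ := mem_image.1 this
  refine ⟨(σ ^ (-(m:ℤ))) x, ?_⟩
  rw [turn_zpow hf, neg_smul, natCast_zsmul, hm]
  ring

theorem qpi_same {f : Fin n → ZMod k} (hf : ∀ x, f (σ⁻¹ x) = f x + τ) {x y : Fin n}
    (h : cyc σ x = cyc σ y) : qpi τ (f x) = qpi τ (f y) := by
  rw [cyc_eq_iff] at h
  obtain ⟨m, rfl⟩ := h
  rw [turn_zpow hf, map_sub, map_zsmul, qpi_tau, smul_zero, sub_zero]

theorem block_card {f : Fin n → ZMod k} (hf : ∀ x, f (σ⁻¹ x) = f x + τ) (c : ZMod k) :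
    (univ.filter fun x => qpi τ (f x) = qpi τ c).card = addOrderOf τ * (univ.filter fun x => f x = c).card := by
  have hd : (univ.filter fun x => qpi τ (f x) = qpi τ c) = univ.filter fun x => f x - c ∈
      (range (addOrderOf τ)).image fun m => m • τ := by
    ext x
    rw [← qpi_ker_eq]
    simp [sub_eq_zero]
  rw [hd, card_eq_sum_card_fiberwise (f := fun x => f x - c) (t := (range (addOrderOf τ)).image fun m => m • τ)]
  swap
  · intro x hx
    simpa using hx
  rw [sum_image]
  swap
  · intro a ha b hb hab
    simp only [coe_range, Set.mem_Iio] at ha hb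
    exact nsmul_injOn_Iio_addOrderOf ha hb hab
  rw [sum_congr rfl (g := fun _ => (univ.filter fun x => f x = c).card), sum_const, card_range, smul_eq_mul]
  intro m hm
  rw [filter_filter]
  refine Finset.card_bij' (fun x _ => (σ ^ (m:ℤ)) x) (fun x _ => (σ ^ (-(m:ℤ))) x) ?_ ?_ ?_ ?_
  · intro x hx
    simp only [mem_filter, mem_univ, true_and] at hx ⊢
    rw [turn_zpow hf, natCast_zsmul, ← hx.2]
    ring
  · intro x hx
    simp only [mem_filter, mem_univ, true_and] at hx ⊢
    have : f ((σ ^ (-(m:ℤ))) x) - c = m • τ := by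
      rw [turn_zpow hf, neg_smul, natCast_zsmul, hx]
      ring
    exact ⟨by rw [this]; exact mem_image_of_mem _ hm, this⟩
  · intro x _
    rw [← Equiv.Perm.mul_apply, ← zpow_add]; simp
  · intro x _
    rw [← Equiv.Perm.mul_apply, ← zpow_add]; simp

/-- reduced weights -/
noncomputable def redw (σ : Equiv.Perm (Fin n)) (τ : ZMod k) (C : ↥(cycleSets σ)) : ℕ := C.1.card / addOrderOf τ

theorem hyp_iff {f : Fin n → ZMod k} (hf : ∀ x, f (σ⁻¹ x) = f x + τ)
    {φ : ↥(cycleSets σ) → ZMod (qK τ)} (hφ : ∀ x, φ (cyc σ x) = qpi τ (f x)) :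
    ¬ Hypersimplicial f ↔ (badFib (qK τ) (redw σ τ) φ).Nonempty := by
  have hw : ∀ C, addOrderOf τ * redw σ τ C = C.1.card := fun C => Nat.mul_div_cancel' (turn_dvd hf C)
  have hwpos : ∀ C, 0 < redw σ τ C := fun C => by
    have h1 := hw C
    have h2 := cyc_card_pos σ C
    rw [← h1] at h2
    exact Nat.pos_of_mul_pos_left h2
  have hop := ord_pos τ
  have hK1 : 0 < qK τ := NeZero.pos _
  have hKk : qK τ ≤ k := Nat.le_of_dvd (NeZero.pos k) (qK_dvd τ)
  have hW : ∀ c : ZMod k, ∑ C ∈ univ.filter (fun C => φ C = qpi τ c), redw σ τ C =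
      (univ.filter fun x => f x = c).card := by
    intro c
    have h1 := block_card hf c
    have h2 := sum_cyc σ (fun C => φ C = qpi τ c)
    simp only [hφ] at h2
    rw [h1, ← sum_congr rfl fun C _ => hw C, ← mul_sum] at h2
    exact (Nat.eq_of_mul_eq_mul_left hop h2).symm
  have hgapK : ∀ c, (∃ i, f i = c) → qK τ ∈ {ℓ : ℕ | 1 ≤ ℓ ∧ ℓ ≤ k ∧ ∃ i, f i = c + (ℓ : ZMod k)} := by
    rintro c ⟨i, rfl⟩
    refine ⟨hK1, hKk, occ_lift hf (x := i) ?_⟩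
    rw [map_add, map_natCast, ZMod.natCast_self, add_zero]
  constructor
  · intro h
    simp only [Hypersimplicial, not_forall, not_lt] at h
    obtain ⟨c, hc, hle⟩ := h
    refine ⟨univ.filter fun C => φ C = qpi τ c, mem_badFib.2 ⟨?_, ?_, qpi τ c, ?_, ?_⟩⟩
    · obtain ⟨i, rfl⟩ := hc
      exact ⟨cyc σ i, by simp [hφ]⟩
    · rw [hW]
      exact hle.trans (Nat.sInf_le (hgapK c hc))
    · intro C hC
      simpa using hC
    · intro C hC
      simp only [mem_filter, mem_univ, true_and] at hC
      rw [hW]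
      refine hle.trans (Nat.sInf_le ⟨?_, ?_, ?_⟩)
      · rw [Nat.one_le_iff_ne_zero, Ne, ZMod.val_eq_zero, sub_eq_zero]
        exact hC
      · exact (ZMod.val_lt _).le.trans hKk
      · obtain ⟨x, rfl⟩ := cyc_surj σ C
        refine occ_lift hf (x := x) ?_
        rw [map_add, map_natCast, ZMod.natCast_zmod_val, hφ]
        ring
  · rintro ⟨p, hp⟩
    obtain ⟨⟨C0, hC0⟩, hpK, q, h1, h2⟩ := mem_badFib.1 hp
    have hWp : 0 < ∑ C ∈ p, redw σ τ C := sumw_pos hwpos ⟨C0, hC0⟩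
    obtain ⟨x0, rfl⟩ := cyc_surj σ C0
    have hq := h1 _ hC0
    rw [hφ] at hq
    have hpe : p = univ.filter fun C => φ C = qpi τ (f x0) := by
      ext C
      simp only [mem_filter, mem_univ, true_and]
      constructor
      · intro h; rw [h1 C h, hq]
      · intro h
        by_contra hC
        have := h2 C hC
        rw [h, hq, sub_self, ZMod.val_zero] at this
        omega
    intro hH
    have h3 := hH (f x0) ⟨x0, rfl⟩
    rw [← hW, ← hpe] at h3
    refine absurd h3 (not_lt.2 (le_csInf ⟨_, hgapK _ ⟨x0, rfl⟩⟩ ?_))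
    rintro ℓ ⟨hl1, hl2, i, hi⟩
    have h4 : φ (cyc σ i) = q + (ℓ : ZMod (qK τ)) := by
      rw [hφ, hi, map_add, map_natCast, hq]
    by_cases hC : cyc σ i ∈ p
    · have h5 := h1 _ hC
      rw [h4] at h5
      have h6 : (ℓ : ZMod (qK τ)) = 0 := by simpa using h5
      rw [ZMod.natCast_eq_zero_iff] at h6
      exact hpK.trans (Nat.le_of_dvd hl1 h6)
    · have h5 := h2 _ hC
      rw [h4, add_sub_cancel_left, ZMod.val_natCast] at h5
      exact h5.trans (Nat.mod_le _ _)

open Classical in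
theorem fiber_card (hdiv : ∀ C : ↥(cycleSets σ), addOrderOf τ ∣ C.1.card)
    (φ : ↥(cycleSets σ) → ZMod (qK τ)) :
    (univ.filter fun f : Fin n → ZMod k => (∀ x, f (σ⁻¹ x) = f x + τ) ∧
      ∀ x, φ (cyc σ x) = qpi τ (f x)).card = addOrderOf τ ^ (cycleSets σ).card := by
  choose rep hrep using cyc_surj σ
  have ht : ∀ x, ∃ m : ℤ, (σ ^ m) (rep (cyc σ x)) = x := by
    intro x
    have := (cyc_eq_iff σ (rep (cyc σ x)) x).1 (hrep _)
    exact this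
  choose t ht using ht
  have hper : ∀ (y : Fin n) (m : ℤ), (σ ^ m) y = y → m • τ = 0 := by
    intro y m hm
    rw [zpow_fix_iff] at hm
    obtain ⟨a, ha⟩ := hdiv (cyc σ y)
    obtain ⟨b, rfl⟩ := hm
    rw [ha]
    push_cast
    rw [mul_assoc, mul_comm, mul_smul, natCast_zsmul, addOrderOf_nsmul_eq_zero, smul_zero]
  have hc1 : ∀ x, cyc σ (σ⁻¹ x) = cyc σ x := by
    intro x
    rw [cyc_eq_iff]
    exact ⟨1, by simp⟩
  have hd : ∀ x, -(t (σ⁻¹ x) • τ) = -(t x • τ) + τ := by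
    intro x
    have h1 := ht (σ⁻¹ x)
    rw [hc1] at h1
    have h2 : (σ ^ (- t x + 1 + t (σ⁻¹ x))) (rep (cyc σ x)) = rep (cyc σ x) := by
      rw [zpow_add, Equiv.Perm.mul_apply, h1, zpow_add, Equiv.Perm.mul_apply, zpow_one,
        show σ (σ⁻¹ x) = x by simp, zpow_neg, Equiv.Perm.inv_eq_iff_eq, ht]
    have h3 := hper _ _ h2
    rw [add_smul, add_smul, neg_smul, one_smul] at h3
    linear_combination -h3
  have hd0 : ∀ C, t (rep C) • τ = 0 := by
    intro C
    apply hper (rep C)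
    have := ht (rep C)
    rwa [hrep] at this
  have hcard : (Fintype.piFinset fun C : ↥(cycleSets σ) => univ.filter fun y => qpi τ y = φ C).card =
      addOrderOf τ ^ (cycleSets σ).card := by
    rw [Fintype.card_piFinset, prod_congr rfl fun C _ => qpi_fiber τ (φ C), prod_const, card_univ,
      Fintype.card_coe]
  rw [← hcard]
  refine Finset.card_bij' (fun f _ C => f (rep C)) (fun g _ x => g (cyc σ x) + -(t x • τ)) ?_ ?_ ?_ ?_
  · intro f hf
    simp only [mem_filter, mem_univ, true_and] at hf
    rw [Fintype.mem_piFinset]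
    intro C
    simp only [mem_filter, mem_univ, true_and]
    rw [← hf.2, hrep]
  · intro g hg
    rw [Fintype.mem_piFinset] at hg
    simp only [mem_filter, mem_univ, true_and] at hg ⊢
    refine ⟨fun x => ?_, fun x => ?_⟩
    · rw [hc1, hd]; ring
    · rw [map_add, hg, map_neg, map_zsmul, qpi_tau, smul_zero, neg_zero, add_zero]
  · intro f hf
    simp only [mem_filter, mem_univ, true_and] at hf
    funext x
    have := turn_zpow hf.1 (t x) (rep (cyc σ x))
    rw [ht] at this
    rw [this]; ring
  · intro g hg
    funext C
    simp only [hrep, hd0]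
    simp

open Classical in
theorem card_turn (hdiv : ∀ C : ↥(cycleSets σ), addOrderOf τ ∣ C.1.card) :
    (univ.filter fun f : Fin n → ZMod k => (∀ x, f (σ⁻¹ x) = f x + τ) ∧ ¬ Hypersimplicial f).card =
    (univ.filter fun φ : ↥(cycleSets σ) → ZMod (qK τ) => (badFib (qK τ) (redw σ τ) φ).Nonempty).card *
      addOrderOf τ ^ (cycleSets σ).card := by
  choose rep hrep using cyc_surj σ
  rw [card_eq_sum_card_fiberwise (f := fun f C => qpi τ (f (rep C))) (t := (univ.filter fun φ : ↥(cycleSets σ) → ZMod (qK τ) => (badFib (qK τ) (redw σ τ) φ).Nonempty))]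
  · rw [← smul_eq_mul, ← sum_const]
    refine sum_congr rfl fun φ hφ => ?_
    rw [← fiber_card hdiv φ, filter_filter]
    simp only [mem_filter, mem_univ, true_and] at hφ
    congr 1
    ext f
    simp only [mem_filter, mem_univ, true_and]
    constructor
    · rintro ⟨⟨h1, h2⟩, h3⟩
      refine ⟨h1, fun x => ?_⟩
      rw [← h3]
      exact qpi_same h1 (hrep _)
    · rintro ⟨h1, h2⟩
      refine ⟨⟨h1, (hyp_iff h1 h2).2 hφ⟩, ?_⟩
      funext C
      rw [← h2, hrep]
  · intro f hf
    simp only [coe_filter, mem_univ, true_and, Set.mem_ofPred_eq] at hf ⊢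
    refine (hyp_iff hf.1 fun x => ?_).1 hf.2
    exact qpi_same hf.1 (hrep _)
end Quot
end Per

theorem gapLen_shift {n k : ℕ} (f : Fin n → ZMod k) (c y : ZMod k) :
    gapLen (fun i => f i + c) y = gapLen f (y - c) := by
  unfold gapLen
  congr 1
  ext ℓ
  refine and_congr_right fun _ => and_congr_right fun _ => exists_congr fun i => ?_
  constructor
  · intro h; linear_combination h
  · intro h; linear_combination h

theorem hyp_shift {n k : ℕ} (f : Fin n → ZMod k) (c : ZMod k) (h : Hypersimplicial fun i => f i + c) :
    Hypersimplicial f := by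
  rintro y ⟨i, hi⟩
  have h1 := h (y + c) ⟨i, by simp [hi]⟩
  rw [gapLen_shift, add_sub_cancel_right] at h1
  simpa using h1

open Classical in
theorem card_dosps {n k : ℕ} [NeZero k] (hn : 0 < n) (σ : Equiv.Perm (Fin n)) :
    (Set.ncard {D : Quotient (dospSetoid n k) |
        ∃ f : Fin n → ZMod k, Quotient.mk (dospSetoid n k) f = D ∧
          (∃ τ : ZMod k, ∀ x, f (σ⁻¹ x) = f x + τ) ∧ ¬ Hypersimplicial f}) * k =
      (univ.filter fun f : Fin n → ZMod k => (∃ τ : ZMod k, ∀ x, f (σ⁻¹ x) = f x + τ) ∧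
        ¬ Hypersimplicial f).card := by
  set B := univ.filter fun f : Fin n → ZMod k => (∃ τ : ZMod k, ∀ x, f (σ⁻¹ x) = f x + τ) ∧
        ¬ Hypersimplicial f with hB
  have h1 : {D : Quotient (dospSetoid n k) |
        ∃ f : Fin n → ZMod k, Quotient.mk (dospSetoid n k) f = D ∧
          (∃ τ : ZMod k, ∀ x, f (σ⁻¹ x) = f x + τ) ∧ ¬ Hypersimplicial f} =
      ((B.image (Quotient.mk (dospSetoid n k)) : Finset _) : Set _) := by
    ext D
    simp only [Set.mem_ofPred_eq, coe_image, Set.mem_image, mem_coe, hB, mem_filter, mem_univ, true_and]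
    exact exists_congr fun f => and_comm
  rw [h1, Set.ncard_coe_finset, card_eq_sum_card_image (Quotient.mk (dospSetoid n k)) B,
    ← smul_eq_mul, ← sum_const]
  refine sum_congr rfl fun D hD => ?_
  obtain ⟨f, hf, rfl⟩ := mem_image.1 hD
  have h2 : (B.filter fun g => Quotient.mk (dospSetoid n k) g = Quotient.mk (dospSetoid n k) f) =
      univ.image fun c : ZMod k => fun i => f i + c := by
    ext g
    simp only [mem_filter, mem_image, mem_univ, true_and]
    constructor
    · rintro ⟨-, h⟩
      obtain ⟨c, hc⟩ := Quotient.exact h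
      exact ⟨c, funext fun i => (hc i).symm⟩
    · rintro ⟨c, rfl⟩
      simp only [hB, mem_filter, mem_univ, true_and] at hf ⊢
      obtain ⟨⟨τ, hτ⟩, hh⟩ := hf
      refine ⟨⟨⟨τ, fun x => ?_⟩, fun h => hh (hyp_shift f c h)⟩, Quotient.sound ⟨c, fun i => rfl⟩⟩
      rw [hτ]; ring
  rw [h2, card_image_of_injective, card_univ, ZMod.card]
  intro c c' h
  have := congrFun h ⟨0, hn⟩
  simpa using this

theorem sum_card_cycles {n : ℕ} (σ : Equiv.Perm (Fin n)) :
    ∑ C : ↥(cycleSets σ), C.1.card = n := by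
  have := sum_cyc σ (fun _ => True)
  simpa using this.symm

open Classical in
theorem card_turn_formula {n k : ℕ} [NeZero k] (hkn : k < n) {σ : Equiv.Perm (Fin n)} {τ : ZMod k}
    (hdiv : ∀ C : ↥(cycleSets σ), addOrderOf τ ∣ C.1.card) :
    ((univ.filter fun f : Fin n → ZMod k => (∀ x, f (σ⁻¹ x) = f x + τ) ∧ ¬ Hypersimplicial f).card : ℚ) =
      k * ∑ h ∈ Finset.Icc 1 (k-1), (-1 : ℚ) ^ (h+1) *
          ∑ i ∈ Finset.Icc h (k-1), ∑ j ∈ Finset.Icc 1 i,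
            (∏ b ∈ Finset.Icc 1 (h-1), (((k : ℚ) - (i : ℚ)) / (addOrderOf τ : ℚ) + (b : ℚ))) *
            (addOrderOf τ : ℚ) ^ (j-1) * ((k : ℚ) - (i : ℚ)) ^ ((cycleSets σ).card-j) *
            (∑ I ∈ (Iset k i).filter (fun I => ∑ t, I t = j),
              ∏ t : Fin (k-1), (Nat.choose (cycleCount σ ((t : ℕ) + 1)) (I t) : ℚ)) *
            (stirling2 j h : ℚ) := by
  have hw : ∀ C, addOrderOf τ * redw σ τ C = C.1.card := fun C => Nat.mul_div_cancel' (hdiv C)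
  have hwpos : ∀ C, 0 < redw σ τ C := fun C => by
    have h1 := hw C
    have h2 := cyc_card_pos σ C
    rw [← h1] at h2
    exact Nat.pos_of_mul_pos_left h2
  have hop := ord_pos τ
  have hqk := qK_mul τ
  have hsw : ∀ J : Finset ↥(cycleSets σ), ∑ C ∈ J, C.1.card = addOrderOf τ * ∑ C ∈ J, redw σ τ C := by
    intro J
    rw [mul_sum]
    exact sum_congr rfl fun C _ => (hw C).symm
  have hK : qK τ < ∑ C, redw σ τ C := by
    have h1 := hsw univ
    rw [sum_card_cycles] at h1
    rw [← hqk, h1] at hkn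
    exact Nat.lt_of_mul_lt_mul_left hkn
  have hcc : ∀ t, cycleCount σ t = (univ.filter fun C : ↥(cycleSets σ) => C.1.card = t).card := by
    intro t
    rw [cycleCount, ← card_map (Function.Embedding.subtype _)]
    congr 1
    ext C
    simp only [mem_filter, mem_map, mem_univ, true_and, Function.Embedding.subtype_apply]
    constructor
    · rintro ⟨h1, h2⟩; exact ⟨⟨C, h1⟩, h2, rfl⟩
    · rintro ⟨C, h, rfl⟩; exact ⟨C.2, h⟩
  have hG := sum_fam_group (s := fun C : ↥(cycleSets σ) => C.1.card) (cyc_card_pos σ) k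
    (fun h i j => (∏ b ∈ Finset.Icc 1 (h-1), (((k : ℚ) - (i : ℚ)) / (addOrderOf τ : ℚ) + (b : ℚ))) *
            (addOrderOf τ : ℚ) ^ (j-1) * ((k : ℚ) - (i : ℚ)) ^ ((cycleSets σ).card-j))
  have hR : ∀ i < k, ∀ j, (∑ I ∈ (Iset k i).filter (fun I => ∑ t, I t = j),
              ∏ t : Fin (k-1), (Nat.choose (cycleCount σ ((t : ℕ) + 1)) (I t) : ℚ)) =
      ((univ.filter fun J : Finset ↥(cycleSets σ) => ∑ C ∈ J, C.1.card = i ∧ J.card = j).card : ℚ) := by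
    intro i hi j
    rw [card_subsets_type (fun C : ↥(cycleSets σ) => C.1.card) (cyc_card_pos σ) k i j hi]
    push_cast
    simp only [hcc]
  have hRHS : ∀ h ∈ Icc 1 (k-1), (-1 : ℚ) ^ (h+1) *
          ∑ i ∈ Finset.Icc h (k-1), ∑ j ∈ Finset.Icc 1 i,
            (∏ b ∈ Finset.Icc 1 (h-1), (((k : ℚ) - (i : ℚ)) / (addOrderOf τ : ℚ) + (b : ℚ))) *
            (addOrderOf τ : ℚ) ^ (j-1) * ((k : ℚ) - (i : ℚ)) ^ ((cycleSets σ).card-j) *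
            (∑ I ∈ (Iset k i).filter (fun I => ∑ t, I t = j),
              ∏ t : Fin (k-1), (Nat.choose (cycleCount σ ((t : ℕ) + 1)) (I t) : ℚ)) *
            (stirling2 j h : ℚ) = (-1 : ℚ) ^ (h+1) *
          ∑ i ∈ Finset.Icc h (k-1), ∑ j ∈ Finset.Icc 1 i,
            (∏ b ∈ Finset.Icc 1 (h-1), (((k : ℚ) - (i : ℚ)) / (addOrderOf τ : ℚ) + (b : ℚ))) *
            (addOrderOf τ : ℚ) ^ (j-1) * ((k : ℚ) - (i : ℚ)) ^ ((cycleSets σ).card-j) *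
            ((univ.filter fun J : Finset ↥(cycleSets σ) => ∑ C ∈ J, C.1.card = i ∧ J.card = j).card : ℚ) *
            (stirling2 j h : ℚ) := by
    intro h hh
    congr 1
    refine sum_congr rfl fun i hi => sum_congr rfl fun j _ => ?_
    rw [mem_Icc] at hi hh
    rw [hR i (by omega) j]
  rw [sum_congr rfl hRHS, ← hG, card_turn hdiv]
  push_cast
  rw [card_bad hwpos hK, sum_mul, mul_sum]
  have hfe : (univ.filter (fun P : Finset (Finset ↥(cycleSets σ)) => IsFam P ∧ P.Nonempty ∧ ∑ x ∈ P.biUnion id, redw σ τ x < qK τ)) =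
      univ.filter (fun P : Finset (Finset ↥(cycleSets σ)) => IsFam P ∧ P.Nonempty ∧ ∑ x ∈ P.biUnion id, x.1.card < k) := by
    ext P
    simp only [mem_filter, mem_univ, true_and]
    refine and_congr_right fun _ => and_congr_right fun _ => ?_
    rw [hsw]
    have h5 : addOrderOf τ * ∑ x ∈ P.biUnion id, redw σ τ x < addOrderOf τ * qK τ ↔
        ∑ x ∈ P.biUnion id, redw σ τ x < qK τ := Nat.mul_lt_mul_left hop
    rw [hqk] at h5
    exact h5.symm
  rw [hfe]
  refine sum_congr rfl fun P hP => ?_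
  simp only [mem_filter, mem_univ, true_and] at hP
  have hj1 : 1 ≤ (P.biUnion id).card := (Nat.succ_le_of_lt (card_pos.2 hP.2.1)).trans (fam_card_le hP.1)
  have hjr : (P.biUnion id).card ≤ (cycleSets σ).card := by
    have := card_le_univ (P.biUnion id)
    rwa [Fintype.card_coe] at this
  have hsQ : (∑ x ∈ P.biUnion id, (x.1.card : ℚ)) = addOrderOf τ * ∑ x ∈ P.biUnion id, (redw σ τ x : ℚ) := by
    have := congrArg (Nat.cast : ℕ → ℚ) (hsw (P.biUnion id))
    push_cast at this
    exact this
  have hkQ : (k : ℚ) = addOrderOf τ * qK τ := by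
    rw [← Nat.cast_mul, hqk]
  have hoQ : (addOrderOf τ : ℚ) ≠ 0 := by
    exact_mod_cast hop.ne'
  rw [Fintype.card_coe, hsQ]
  generalize (∑ x ∈ P.biUnion id, (redw σ τ x : ℚ)) = w
  have hdivQ : ((k : ℚ) - addOrderOf τ * w) / addOrderOf τ = qK τ - w := by
    rw [hkQ]; field_simp
  have hsubQ : ((k : ℚ) - addOrderOf τ * w) = addOrderOf τ * (qK τ - w) := by
    rw [hkQ]; ring
  rw [hdivQ, hsubQ, mul_pow]
  obtain ⟨j, hj⟩ : ∃ j, (P.biUnion id).card = j + 1 := ⟨(P.biUnion id).card - 1, by omega⟩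
  obtain ⟨m, hm⟩ : ∃ m, (cycleSets σ).card = j + 1 + m := ⟨(cycleSets σ).card - (j + 1), by omega⟩
  rw [hj, hm, show j + 1 + m - (j + 1) = m by omega, show j + 1 - 1 = j by omega, hkQ]
  ring

/-- Lemma: for 2 ≤ k < n, σ ∈ S_n with cycle lengths s_1,…,s_r, λ_i cycles of
length i, g = gcd(s_1,…,s_r,k) and T = {τ ∈ ℤ/kℤ : g·τ = 0}, the number of σ-fixed
non-hypersimplicial (k,n)-DOSPs equals
Σ_{τ∈T} Σ_{h=1}^{k−1} (−1)^{h+1} Σ_{i=h}^{k−1} Σ_{j=1}^{i}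
  (∏_{b=1}^{h−1} ((k−i)/o(τ) + b)) · o(τ)^{j−1} · (k−i)^{r−j} ·
  (Σ_{I ∈ 𝓘_i, |I| = j} C(λ_1,I_1)⋯C(λ_{k−1},I_{k−1})) · S(j,h),
as an identity of rational numbers. -/
theorem card_fixed_nonhypersimplicial_dosps {n k r : ℕ} [NeZero k]
    (hk : 2 ≤ k) (hkn : k < n)
    (σ : Equiv.Perm (Fin n)) (s : Fin r → ℕ)
    (hs : Multiset.map s Finset.univ.val = Multiset.map Finset.card (cycleSets σ).val) :
    (Set.ncard {D : Quotient (dospSetoid n k) |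
        ∃ f : Fin n → ZMod k, Quotient.mk (dospSetoid n k) f = D ∧
          (∃ τ : ZMod k, ∀ x, f (σ⁻¹ x) = f x + τ) ∧ ¬ Hypersimplicial f} : ℚ) =
      ∑ τ ∈ (Finset.univ : Finset (ZMod k)).filter
          (fun τ => (Nat.gcd (Finset.univ.gcd s) k) • τ = 0),
        ∑ h ∈ Finset.Icc 1 (k-1), (-1 : ℚ) ^ (h+1) *
          ∑ i ∈ Finset.Icc h (k-1), ∑ j ∈ Finset.Icc 1 i,
            (∏ b ∈ Finset.Icc 1 (h-1), (((k : ℚ) - (i : ℚ)) / (addOrderOf τ : ℚ) + (b : ℚ))) *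
            (addOrderOf τ : ℚ) ^ (j-1) * ((k : ℚ) - (i : ℚ)) ^ (r-j) *
            (∑ I ∈ (Iset k i).filter (fun I => ∑ t, I t = j),
              ∏ t : Fin (k-1), (Nat.choose (cycleCount σ ((t : ℕ) + 1)) (I t) : ℚ)) *
            (stirling2 j h : ℚ) := by
  have hn : 0 < n := by omega
  have hk0 : (k : ℚ) ≠ 0 := by exact_mod_cast NeZero.ne k
  have hr : (cycleSets σ).card = r := by
    have := congrArg Multiset.card hs
    simpa using this.symm
  have hT : ∀ τ : ZMod k, (Nat.gcd (Finset.univ.gcd s) k) • τ = 0 ↔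
      ∀ C : ↥(cycleSets σ), addOrderOf τ ∣ C.1.card := by
    intro τ
    rw [← addOrderOf_dvd_iff_nsmul_eq_zero, Nat.dvd_gcd_iff, Finset.dvd_gcd_iff]
    constructor
    · rintro ⟨h, -⟩ C
      have : C.1.card ∈ Multiset.map s Finset.univ.val := by
        rw [hs]; exact Multiset.mem_map.2 ⟨C.1, C.2, rfl⟩
      obtain ⟨b, -, hb⟩ := Multiset.mem_map.1 this
      rw [← hb]
      exact h b (Finset.mem_univ b)
    · intro h
      refine ⟨fun b _ => ?_, ord_dvd τ⟩
      have : s b ∈ Multiset.map Finset.card (cycleSets σ).val := by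
        rw [← hs]; exact Multiset.mem_map.2 ⟨b, Finset.mem_univ_val b, rfl⟩
      obtain ⟨C, hC, hb⟩ := Multiset.mem_map.1 this
      rw [← hb]
      exact h ⟨C, hC⟩
  have h1 := congrArg (Nat.cast : ℕ → ℚ) (card_dosps (k := k) hn σ)
  push_cast at h1
  refine mul_right_cancel₀ hk0 (h1.trans ?_)
  classical
  have h2 : (univ.filter fun f : Fin n → ZMod k => (∃ τ : ZMod k, ∀ x, f (σ⁻¹ x) = f x + τ) ∧
        ¬ Hypersimplicial f) =
      ((Finset.univ : Finset (ZMod k)).filter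
          (fun τ => (Nat.gcd (Finset.univ.gcd s) k) • τ = 0)).biUnion fun τ =>
        univ.filter fun f : Fin n → ZMod k => (∀ x, f (σ⁻¹ x) = f x + τ) ∧ ¬ Hypersimplicial f := by
    ext f
    simp only [mem_filter, mem_univ, true_and, mem_biUnion]
    constructor
    · rintro ⟨⟨τ, h⟩, h'⟩
      exact ⟨τ, (hT τ).2 (turn_dvd h), h, h'⟩
    · rintro ⟨τ, -, h, h'⟩
      exact ⟨⟨τ, h⟩, h'⟩
  have h3 := congrArg Finset.card h2
  rw [card_biUnion] at h3
  swap
  · intro τ _ τ' _ hne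
    simp only [Function.onFun]
    rw [Finset.disjoint_left]
    intro f hf hf'
    simp only [mem_filter, mem_univ, true_and] at hf hf'
    have e1 := hf.1 ⟨0, hn⟩
    have e2 := hf'.1 ⟨0, hn⟩
    rw [e1] at e2
    exact hne (add_left_cancel e2)
  have h4 := congrArg (Nat.cast : ℕ → ℚ) h3
  push_cast at h4
  refine (Eq.trans ?_ h4).trans ?_
  · congr!
  rw [sum_mul]
  refine sum_congr rfl fun τ hτ => ?_
  rw [card_turn_formula hkn ((hT τ).1 (mem_filter.1 hτ).2), hr, mul_comm]
end

section
/- Let n > 2. For every σ ∈ S_n, the number of σ-fixed hypersimplicial (2,n)-DOSPs equals 1 + #{unordered partitions {A,B} of [n] into two parts with |A| ≥ 2 and |B| ≥ 2 such that {σ(A),σ(B)} = {A,B}}. (Equivalently, H*(Δ_{2,n}; S_n)[1] = χ_0 + τ_2 + τ_3 + ⋯ + τ_{⌊n/2⌋}, where χ_0 is the trivial character and τ_m is the permutation character of S_n acting on partitions of [n] into a part of size m and a part of size n−m.) -/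
open Finset

/-- The number of σ-fixed hypersimplicial (k,n)-DOSPs. -/
noncomputable def hypDospCount (n k : ℕ) (σ : Equiv.Perm (Fin n)) : ℕ :=
  Set.ncard {D : Quotient (dospSetoid n k) |
    ∃ f : Fin n → ZMod k, Quotient.mk (dospSetoid n k) f = D ∧
      (∃ τ : ZMod k, ∀ i, f (σ⁻¹ i) = f i + τ) ∧ Hypersimplicial f}

/-- The zero set of a function. -/
def zset {n : ℕ} (f : Fin n → ZMod 2) : Finset (Fin n) := Finset.univ.filter fun i => f i = 0

/-- The unordered partition attached to a function. -/
def ptn {n : ℕ} (f : Fin n → ZMod 2) : Finset (Finset (Fin n)) := {zset f, (zset f)ᶜ}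

theorem zmod_two_cases (x : ZMod 2) : x = 0 ∨ x = 1 := by
  revert x; decide

theorem mem_zset {n : ℕ} (f : Fin n → ZMod 2) (i : Fin n) : i ∈ zset f ↔ f i = 0 := by
  simp [zset]

theorem compl_zset {n : ℕ} (f : Fin n → ZMod 2) :
    (zset f)ᶜ = Finset.univ.filter fun i => f i = 1 := by
  ext i
  have := zmod_two_cases (f i)
  have h01 : (0 : ZMod 2) ≠ 1 := by decide
  simp only [Finset.mem_compl, mem_zset, Finset.mem_filter, Finset.mem_univ, true_and]
  rcases this with h | h <;> simp [h]

theorem pair_compl_eq {n : ℕ} {A B : Finset (Fin n)} :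
    ({A, Aᶜ} : Finset (Finset (Fin n))) = {B, Bᶜ} ↔ A = B ∨ A = Bᶜ := by
  constructor
  · intro h
    have : A ∈ ({B, Bᶜ} : Finset (Finset (Fin n))) := by rw [← h]; simp
    simpa using this
  · rintro (rfl | rfl)
    · rfl
    · rw [compl_compl, Finset.pair_comm]

theorem zset_eq_iff {n : ℕ} (f g : Fin n → ZMod 2) : zset f = zset g ↔ ∀ i, f i = g i := by
  have key : ∀ x y : ZMod 2, (x = 0 ↔ y = 0) ↔ x = y := by decide
  simp only [Finset.ext_iff, mem_zset, key]

theorem zset_eq_compl_iff {n : ℕ} (f g : Fin n → ZMod 2) :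
    zset f = (zset g)ᶜ ↔ ∀ i, f i = g i + 1 := by
  have key : ∀ x y : ZMod 2, (x = 0 ↔ ¬ y = 0) ↔ x = y + 1 := by decide
  simp only [Finset.ext_iff, mem_zset, Finset.mem_compl, key]

theorem rel_iff_ptn {n : ℕ} (f g : Fin n → ZMod 2) :
    (∃ c : ZMod 2, ∀ i, f i = g i + c) ↔ ptn f = ptn g := by
  unfold ptn
  rw [pair_compl_eq, zset_eq_iff, zset_eq_compl_iff]
  constructor
  · rintro ⟨c, hc⟩
    rcases zmod_two_cases c with rfl | rfl
    · left; simpa using hc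
    · right; exact hc
  · rintro (h | h)
    · exact ⟨0, by simpa using h⟩
    · exact ⟨1, h⟩

theorem image_perm_compl {n : ℕ} (σ : Equiv.Perm (Fin n)) (A : Finset (Fin n)) :
    Aᶜ.image σ = (A.image σ)ᶜ := by
  apply Finset.coe_injective
  push_cast
  exact Set.image_compl_eq σ.bijective

theorem ptn_perm {n : ℕ} (f : Fin n → ZMod 2) (σ : Equiv.Perm (Fin n)) :
    ptn (fun i => f (σ⁻¹ i)) = (ptn f).image (fun B => B.image σ) := by
  have h : zset (fun i => f (σ⁻¹ i)) = (zset f).image σ := by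
    ext i
    simp only [mem_zset, Finset.mem_image]
    constructor
    · intro hi
      exact ⟨σ⁻¹ i, hi, by simp⟩
    · rintro ⟨j, hj, rfl⟩
      simpa using hj
  unfold ptn
  rw [Finset.image_insert, Finset.image_singleton, h, image_perm_compl]

theorem gapLen_one {n : ℕ} (f : Fin n → ZMod 2) (c : ZMod 2) (h : ∃ i, f i = c + 1) :
    gapLen f c = 1 := by
  unfold gapLen
  apply le_antisymm
  · apply Nat.sInf_le
    exact ⟨le_rfl, by norm_num, by simpa using h⟩
  · apply le_csInf
    · exact ⟨1, le_rfl, by norm_num, by simpa using h⟩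
    · intro b hb; exact hb.1

theorem gapLen_le_two {n : ℕ} (f : Fin n → ZMod 2) (c : ZMod 2) (h : ∃ i, f i = c) :
    gapLen f c ≤ 2 := by
  unfold gapLen
  apply Nat.sInf_le
  refine ⟨by norm_num, le_rfl, ?_⟩
  have : ((2 : ℕ) : ZMod 2) = 0 := by decide
  rw [this, add_zero]
  exact h

theorem hyp_iff_s16 {n : ℕ} (hn : 2 < n) (f : Fin n → ZMod 2) :
    Hypersimplicial f ↔
      ptn f = {Finset.univ, Finset.univᶜ} ∨ (2 ≤ (zset f).card ∧ 2 ≤ (zset f)ᶜ.card) := by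
  have h11 : (1 : ZMod 2) + 1 = 0 := by decide
  unfold ptn
  rw [pair_compl_eq]
  constructor
  · intro h
    by_cases h0 : ∃ i, f i = 0
    · by_cases h1 : ∃ i, f i = 1
      · right
        have a := h 0 h0
        have b := h 1 h1
        rw [gapLen_one f 0 (by simpa using h1)] at a
        rw [gapLen_one f 1 (by simpa [h11] using h0), ← compl_zset] at b
        exact ⟨a, b⟩
      · left; left
        ext i
        have := zmod_two_cases (f i)
        push Not at h1
        simpa [mem_zset, h1 i] using this
    · left; right
      push Not at h0
      ext i
      simp [mem_zset, h0 i]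
  · rintro ((h | h) | ⟨ha, hb⟩) c hc
    · have hf : ∀ i, f i = 0 := fun i => by rw [← mem_zset, h]; simp
      obtain ⟨i, hi⟩ := hc
      have hc0 : c = 0 := by rw [← hi, hf i]
      refine lt_of_le_of_lt (gapLen_le_two f c ⟨i, hi⟩) ?_
      simpa [hf, hc0] using hn
    · have hf : ∀ i, f i = 1 := fun i => by
        have : ¬ f i = 0 := by rw [← mem_zset, h]; simp
        exact (zmod_two_cases (f i)).resolve_left this
      obtain ⟨i, hi⟩ := hc
      have hc0 : c = 1 := by rw [← hi, hf i]
      refine lt_of_le_of_lt (gapLen_le_two f c ⟨i, hi⟩) ?_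
      simpa [hf, hc0] using hn
    · have h0 : ∃ i, f i = 0 := by
        obtain ⟨i, hi⟩ := Finset.card_pos.mp (show 0 < (zset f).card by omega)
        exact ⟨i, (mem_zset f i).mp hi⟩
      have h1 : ∃ i, f i = 1 := by
        obtain ⟨i, hi⟩ := Finset.card_pos.mp (show 0 < (zset f)ᶜ.card by omega)
        rw [compl_zset] at hi
        exact ⟨i, by simpa using hi⟩
      rcases zmod_two_cases c with rfl | rfl
      · rw [gapLen_one f 0 (by simpa using h1)]
        exact ha
      · rw [gapLen_one f 1 (by simpa [h11] using h0), ← compl_zset]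
        exact hb

theorem exists_zset {n : ℕ} (A : Finset (Fin n)) : ∃ f : Fin n → ZMod 2, zset f = A := by
  refine ⟨fun i => if i ∈ A then 0 else 1, ?_⟩
  ext i
  simp [mem_zset]

/-- The partition attached to a DOSP. -/
def dospPtn (n : ℕ) : Quotient (dospSetoid n 2) → Finset (Finset (Fin n)) :=
  Quotient.lift ptn fun f g h => (rel_iff_ptn f g).mp h

theorem dospPtn_injective (n : ℕ) : Function.Injective (dospPtn n) := by
  intro D E
  induction D using Quotient.inductionOn with | _ f
  induction E using Quotient.inductionOn with | _ g
  intro h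
  exact Quotient.sound ((rel_iff_ptn f g).mpr h)

/-- Theorem: for n > 2 and σ ∈ S_n, the number of σ-fixed hypersimplicial
(2,n)-DOSPs equals 1 plus the number of unordered partitions {A, B} of [n] into two
parts of size ≥ 2 with {σ(A), σ(B)} = {A, B}. -/
theorem card_fixed_hypersimplicial_two_dosps {n : ℕ} (hn : 2 < n)
    (σ : Equiv.Perm (Fin n)) :
    hypDospCount n 2 σ =
      1 + Set.ncard {P : Finset (Finset (Fin n)) |
        (∃ A : Finset (Fin n), P = {A, Aᶜ} ∧ 2 ≤ A.card ∧ 2 ≤ Aᶜ.card) ∧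
        P.image (fun B => B.image σ) = P} := by
  unfold hypDospCount
  rw [← Set.ncard_image_of_injective _ (dospPtn_injective n), add_comm 1]
  rw [← Set.ncard_insert_of_notMem (a := ({Finset.univ, Finset.univᶜ} : Finset (Finset (Fin n))))
    ?_ (Set.toFinite _)]
  · congr 1
    ext P
    simp only [Set.mem_image, Set.mem_ofPred_eq, Set.mem_insert_iff]
    constructor
    · rintro ⟨D, ⟨f, rfl, hfix, hyp⟩, rfl⟩
      change ptn f = _ ∨ (∃ A, ptn f = _ ∧ _) ∧ (ptn f).image _ = ptn f
      rcases (hyp_iff_s16 hn f).mp hyp with h | h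
      · exact Or.inl h
      · refine Or.inr ⟨⟨zset f, rfl, h⟩, ?_⟩
        rw [← ptn_perm]
        exact (rel_iff_ptn _ f).mp hfix
    · intro h
      have key : ∃ A : Finset (Fin n), P = {A, Aᶜ} ∧
          (P = {Finset.univ, Finset.univᶜ} ∨ (2 ≤ A.card ∧ 2 ≤ Aᶜ.card)) ∧
          P.image (fun B => B.image σ) = P := by
        rcases h with h | ⟨⟨A, hA, h2⟩, h3⟩
        · refine ⟨Finset.univ, h, Or.inl h, ?_⟩
          rw [h, Finset.image_insert, Finset.image_singleton,
            image_perm_compl,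
            Finset.image_univ_of_surjective σ.surjective]
        · exact ⟨A, hA, Or.inr h2, h3⟩
      obtain ⟨A, hA, h2, h3⟩ := key
      obtain ⟨f, rfl⟩ := exists_zset A
      change P = ptn f at hA
      subst hA
      refine ⟨Quotient.mk _ f, ⟨f, rfl, ?_, (hyp_iff_s16 hn f).mpr h2⟩, rfl⟩
      rw [← ptn_perm] at h3
      exact (rel_iff_ptn _ f).mpr h3
  · rintro ⟨⟨A, hA, h1, h2⟩, -⟩
    rcases pair_compl_eq.mp hA with h | h
    · rw [← h] at h2
      simp at h2
    · have : A = ∅ := by rw [← compl_compl A, ← h]; simp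
      rw [this] at h1
      simp at h1
end

section
/- Let n be a positive even integer. For every permutation σ ∈ S_n, the number of subsets A ⊆ [n] with |A| even and σ(A) = A equals the number of unordered pairs {A, [n]∖A} (with A possibly empty) such that {σ(A), σ([n]∖A)} = {A, [n]∖A}. Equivalently, Σ_{m=0}^{n/2} ρ_{2m}(σ) = Σ_{m=0}^{n/2} τ_m(σ), where ρ_j(σ) counts σ-invariant j-subsets of [n] and τ_m(σ) counts σ-invariant unordered partitions of [n] into a part of size m and a part of size n−m. -/
open Finset

namespace EvenInv

variable {n : ℕ}

lemma image_eq_iff (σ : Equiv.Perm (Fin n)) (A B : Finset (Fin n)) :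
    A.image σ = B ↔ ∀ x, σ x ∈ B ↔ x ∈ A := by
  constructor
  · rintro rfl x
    simp
  · intro h
    ext y
    obtain ⟨x, rfl⟩ := σ.surjective y
    rw [h x]
    simp

lemma image_compl_perm (σ : Equiv.Perm (Fin n)) (A : Finset (Fin n)) :
    (Aᶜ).image σ = (A.image σ)ᶜ := by
  rw [image_eq_iff]
  intro x
  simp

lemma exists_swap (σ : Equiv.Perm (Fin n))
    (h : ∀ A : Finset (Fin n), A.image σ = A → Even A.card) :
    ∃ B : Finset (Fin n), B.image σ = Bᶜ := by
  classical
  have hper : ∀ (r : Fin n) (k : ℤ), (σ ^ k) r = r → Even k := by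
    intro r k hk
    have hd := (MulAction.zpow_smul_eq_iff_minimalPeriod_dvd (a := σ) (b := r) (n := k)).1 hk
    have hc := h (univ.filter fun x => x ∈ MulAction.orbit (Subgroup.zpowers σ) r) (by
      rw [image_eq_iff]
      intro x
      simp only [mem_filter, mem_univ, true_and]
      rw [← MulAction.orbit_eq_iff, ← MulAction.orbit_eq_iff]
      have := MulAction.orbit_smul (⟨σ, Subgroup.mem_zpowers σ⟩ : Subgroup.zpowers σ) x
      exact Eq.congr_left this)
    rw [MulAction.minimalPeriod_eq_card] at hd
    rw [Fintype.card_subtype] at hd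
    have h2 : (2 : ℤ) ∣ _ := Int.natCast_dvd_natCast.2 hc.two_dvd
    exact even_iff_two_dvd.2 (h2.trans hd)
  let s := Equiv.Perm.SameCycle.setoid σ
  let r : Fin n → Fin n := fun x => (Quotient.mk s x).out
  have hr : ∀ x, ∃ i : ℤ, (σ ^ i) (r x) = x := fun x => Quotient.mk_out (s := s) x
  choose i hi using hr
  have hrs : ∀ x, r (σ x) = r x := by
    intro x
    have : Quotient.mk s (σ x) = Quotient.mk s x :=
      Quotient.sound (s := s) (Equiv.Perm.sameCycle_apply_left.2 (Equiv.Perm.SameCycle.refl σ x))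
    simp only [r, this]
  refine ⟨univ.filter fun x => Even (i x), ?_⟩
  rw [image_eq_iff]
  intro x
  have h1 := hi (σ x)
  rw [hrs] at h1
  have h2 : (σ ^ (-(i x + 1) + i (σ x))) (r x) = r x := by
    rw [zpow_add, Equiv.Perm.mul_apply, h1, zpow_neg, Equiv.Perm.inv_eq_iff_eq,
      add_comm, zpow_add, Equiv.Perm.mul_apply, hi x, zpow_one]
  have h3 := hper _ _ h2
  simp only [mem_compl, mem_filter, mem_univ, true_and]
  grind

lemma card_two (hn : 0 < n) (σ : Equiv.Perm (Fin n)) :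
    (univ.filter fun A : Finset (Fin n) => A.image σ = A ∨ A.image σ = Aᶜ).card =
    Set.ncard {P : Finset (Finset (Fin n)) |
        (∃ A : Finset (Fin n), P = {A, Aᶜ}) ∧
        P.image (fun B => B.image σ) = P} * 2 := by
  classical
  set S := (univ.filter fun A : Finset (Fin n) => A.image σ = A ∨ A.image σ = Aᶜ) with hS
  have hset : {P : Finset (Finset (Fin n)) |
        (∃ A : Finset (Fin n), P = {A, Aᶜ}) ∧
        P.image (fun B => B.image σ) = P} =
      ((S.image fun A => ({A, Aᶜ} : Finset (Finset (Fin n)))) : Set _) := by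
    ext P
    simp only [Set.mem_ofPred_eq, coe_image, Set.mem_image, hS, coe_filter, mem_univ, true_and]
    constructor
    · rintro ⟨⟨A, rfl⟩, h⟩
      refine ⟨A, ?_, rfl⟩
      have : A.image σ ∈ ({A, Aᶜ} : Finset (Finset (Fin n))) := by
        rw [← h]
        exact mem_image_of_mem (fun B : Finset (Fin n) => B.image σ) (mem_insert_self _ _)
      simpa using this
    · rintro ⟨A, h, rfl⟩
      refine ⟨⟨A, rfl⟩, ?_⟩
      rw [image_insert, image_singleton, image_compl_perm]
      rcases h with h | h
      · rw [h]
      · rw [h, compl_compl, pair_comm]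
  rw [hset, Set.ncard_coe_finset, card_eq_sum_card_image (fun A => ({A, Aᶜ} : Finset (Finset (Fin n)))) S]
  apply sum_const_nat
  intro P hP
  obtain ⟨A, hA, rfl⟩ := mem_image.1 hP
  have hne : A ≠ Aᶜ := by
    intro h
    have := Finset.ext_iff.1 h ⟨0, hn⟩
    simp at this
  rw [← card_pair hne]
  congr 1
  ext B
  simp only [mem_filter]
  constructor
  · rintro ⟨_, h⟩
    rw [← h]
    simp
  · intro h
    rw [mem_insert, mem_singleton] at h
    rcases h with rfl | rfl
    · exact ⟨hA, rfl⟩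
    · refine ⟨?_, by rw [compl_compl, pair_comm]⟩
      simp only [hS, mem_filter, mem_univ, true_and] at hA ⊢
      rw [image_compl_perm, compl_inj_iff, compl_inj_iff]
      exact hA

lemma card_symmDiff_parity (A O : Finset (Fin n)) :
    (symmDiff A O).card + 2 * (A ∩ O).card = A.card + O.card := by
  have h1 := card_sdiff_add_card_inter A O
  have h2 := card_sdiff_add_card_inter O A
  have h3 : (symmDiff A O).card = (A \ O).card + (O \ A).card :=
    card_union_of_disjoint disjoint_sdiff_sdiff
  rw [inter_comm O A] at h2
  omega

lemma two_mul_card (hn : 0 < n) (σ : Equiv.Perm (Fin n)) :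
    (univ.filter fun A : Finset (Fin n) => A.image σ = A ∨ A.image σ = Aᶜ).card =
    (univ.filter fun A : Finset (Fin n) => Even A.card ∧ A.image σ = A).card * 2 := by
  classical
  by_cases h : ∀ A : Finset (Fin n), A.image σ = A → Even A.card
  · obtain ⟨B, hB⟩ := exists_swap σ h
    have hE : (univ.filter fun A : Finset (Fin n) => Even A.card ∧ A.image σ = A) =
        univ.filter fun A : Finset (Fin n) => A.image σ = A := by
      ext A
      simp only [mem_filter, mem_univ, true_and]
      exact ⟨fun h => h.2, fun hA => ⟨h A hA, hA⟩⟩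
    rw [hE, filter_or, card_union_of_disjoint, mul_two]
    · congr 1
      symm
      apply card_bij' (fun A _ => symmDiff A B) (fun A _ => symmDiff A B)
      · intro A hA
        simp only [mem_filter, mem_univ, true_and, image_eq_iff, mem_compl, mem_symmDiff] at *
        grind
      · intro A hA
        simp only [mem_filter, mem_univ, true_and, image_eq_iff, mem_compl, mem_symmDiff] at *
        grind
      · intro A _
        exact symmDiff_symmDiff_cancel_right _ _
      · intro A _
        exact symmDiff_symmDiff_cancel_right _ _
    · rw [disjoint_left]
      intro A h1 h2
      simp only [mem_filter, mem_univ, true_and] at h1 h2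
      have := Finset.ext_iff.1 (h1.symm.trans h2) ⟨0, hn⟩
      simp at this
  · push Not at h
    obtain ⟨O, hO, hodd⟩ := h
    have hC : ∀ A : Finset (Fin n), A.image σ ≠ Aᶜ := by
      intro A hA
      apply hodd
      have h1 : (O ∩ A).image σ = O \ A := by
        rw [image_eq_iff] at *
        intro x
        have := hO x
        have := hA x
        simp only [mem_compl, mem_inter, mem_sdiff] at *
        tauto
      have h2 := card_image_of_injective (O ∩ A) σ.injective
      rw [h1] at h2
      have h3 := card_sdiff_add_card_inter O A
      exact ⟨_, by rw [← h3, h2]⟩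
    have hE : (univ.filter fun A : Finset (Fin n) => A.image σ = A ∨ A.image σ = Aᶜ) =
        (univ.filter fun A : Finset (Fin n) => Even A.card ∧ A.image σ = A) ∪
        (univ.filter fun A : Finset (Fin n) => ¬ Even A.card ∧ A.image σ = A) := by
      ext A
      have := hC A
      simp only [mem_filter, mem_univ, true_and, mem_union]
      tauto
    have hinv : ∀ A : Finset (Fin n), A.image σ = A → (symmDiff A O).image σ = symmDiff A O := by
      intro A hA
      rw [image_eq_iff] at *
      intro x
      rw [mem_symmDiff, mem_symmDiff, hA x, hO x]
    rw [hE, card_union_of_disjoint, mul_two]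
    · congr 1
      symm
      apply card_bij' (fun A _ => symmDiff A O) (fun A _ => symmDiff A O)
      · intro A hA
        simp only [mem_filter, mem_univ, true_and] at *
        have := card_symmDiff_parity A O
        exact ⟨by grind, hinv A hA.2⟩
      · intro A hA
        simp only [mem_filter, mem_univ, true_and] at *
        have := card_symmDiff_parity A O
        exact ⟨by grind, hinv A hA.2⟩
      · intro A _
        exact symmDiff_symmDiff_cancel_right _ _
      · intro A _
        exact symmDiff_symmDiff_cancel_right _ _
    · rw [disjoint_left]
      intro A h1 h2
      simp only [mem_filter, mem_univ, true_and] at h1 h2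
      exact h2.1 h1.1

end EvenInv

/-- Lemma: for n even and any σ ∈ S_n, the number of σ-invariant subsets of [n] of
even size equals the number of σ-invariant unordered partitions {A, [n]∖A} of [n]
(with A possibly empty). -/
theorem card_even_invariant_subsets_eq_card_invariant_partitions {n : ℕ}
    (hn : 0 < n) (heven : Even n) (σ : Equiv.Perm (Fin n)) :
    ((Finset.univ : Finset (Finset (Fin n))).filter
        fun A => Even A.card ∧ A.image σ = A).card =
      Set.ncard {P : Finset (Finset (Fin n)) |
        (∃ A : Finset (Fin n), P = {A, Aᶜ}) ∧
        P.image (fun B => B.image σ) = P} := by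
  have h1 := EvenInv.card_two hn σ
  have h2 := EvenInv.two_mul_card hn σ
  omega
end

section
/- Let n ≥ 4. Then Σ_{σ ∈ S_n} ρ_2(σ) = Σ_{σ ∈ S_n} ρ_1(σ), where ρ_1(σ) is the number of fixed points of σ and ρ_2(σ) is the number of 2-element subsets A ⊆ [n] with σ(A) = A, while ρ_2(id) − ρ_1(id) = C(n,2) − n ≠ 0. Consequently, the multiplicity of the trivial character in the nonzero effective virtual character ρ_2 − ρ_1 is zero, so ρ_2 − ρ_1 (which equals the coefficient H*_1 of the equivariant H*-polynomial of Δ_{2,n} under S_n) is not a permutation character. -/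
open Finset

/-- ρ_1(σ): the number of fixed points of σ on [n]. -/
def rho1 {n : ℕ} (σ : Equiv.Perm (Fin n)) : ℕ :=
  (Finset.univ.filter fun i => σ i = i).card

/-- ρ_2(σ): the number of 2-element subsets A ⊆ [n] with σ(A) = A. -/
def rho2 {n : ℕ} (σ : Equiv.Perm (Fin n)) : ℕ :=
  ((Finset.univ : Finset (Finset (Fin n))).filter
    fun A => A.card = 2 ∧ A.image σ = A).card

/-- Burnside's lemma for a transitive action. -/
theorem burnside_pretransitive {G X : Type} [Group G] [Fintype G] [MulAction G X] [Finite X]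
    [Nonempty X] [MulAction.IsPretransitive G X] :
    ∑ g : G, Nat.card (MulAction.fixedBy X g) = Fintype.card G := by
  classical
  have := Fintype.ofFinite X
  have h := MulAction.sum_card_fixedBy_eq_card_orbits_mul_card_group G X
  have h1 : Fintype.card (Quotient (MulAction.orbitRel G X)) = 1 := by
    rw [Fintype.card_eq_one_iff_nonempty_unique]
    have hs := (MulAction.pretransitive_iff_subsingleton_quotient G X).1 inferInstance
    obtain ⟨x⟩ := ‹Nonempty X›
    exact ⟨⟨⟨Quotient.mk _ x⟩, fun a => hs.elim _ _⟩⟩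
  rw [h1, one_mul] at h
  rw [← h]
  exact Finset.sum_congr rfl fun g _ => Nat.card_eq_fintype_card

theorem rho1_eq {n : ℕ} (σ : Equiv.Perm (Fin n)) :
    rho1 σ = Nat.card (MulAction.fixedBy (Fin n) σ) := by
  rw [rho1, ← Fintype.card_subtype, ← Nat.card_eq_fintype_card]
  rfl

theorem rho2_eq {n : ℕ} (σ : Equiv.Perm (Fin n)) :
    rho2 σ = Nat.card (MulAction.fixedBy (Set.powersetCard (Fin n) 2) σ) := by
  rw [rho2, ← Fintype.card_subtype, ← Nat.card_eq_fintype_card]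
  refine Nat.card_congr
    { toFun := fun A => ⟨⟨A.1, A.2.1⟩, Subtype.ext A.2.2⟩
      invFun := fun B => ⟨B.1.1, B.1.2, congrArg Subtype.val B.2⟩
      left_inv := fun _ => rfl
      right_inv := fun _ => rfl }

/-- Corollary: for n ≥ 4 we have Σ_σ ρ_2(σ) = Σ_σ ρ_1(σ) while
ρ_2(id) − ρ_1(id) = C(n,2) − n ≠ 0; consequently the trivial character has
multiplicity zero in the nonzero virtual character ρ_2 − ρ_1, so ρ_2 − ρ_1 (the
coefficient H*_1 of the equivariant H*-polynomial of Δ_{2,n} under S_n) is not a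
permutation character: there is no action of S_n on a finite set whose
fixed-point-counting character is ρ_2 − ρ_1. -/
theorem rho2_sub_rho1_not_permutation_character {n : ℕ} (hn : 4 ≤ n) :
    (∑ σ : Equiv.Perm (Fin n), (rho2 σ : ℤ)) = (∑ σ : Equiv.Perm (Fin n), (rho1 σ : ℤ)) ∧
    ((rho2 (1 : Equiv.Perm (Fin n)) : ℤ) - (rho1 (1 : Equiv.Perm (Fin n)) : ℤ) =
        (n.choose 2 : ℤ) - (n : ℤ) ∧
      (rho2 (1 : Equiv.Perm (Fin n)) : ℤ) - (rho1 (1 : Equiv.Perm (Fin n)) : ℤ) ≠ 0) ∧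
    ¬ ∃ (X : Type) (_ : Finite X) (φ : Equiv.Perm (Fin n) →* Equiv.Perm X),
        ∀ σ : Equiv.Perm (Fin n),
          (Set.ncard {x : X | φ σ x = x} : ℤ) = (rho2 σ : ℤ) - (rho1 σ : ℤ) := by
  have h1 : (∑ σ : Equiv.Perm (Fin n), (rho2 σ : ℤ)) =
      (∑ σ : Equiv.Perm (Fin n), (rho1 σ : ℤ)) := by
    have : Nonempty (Fin n) := ⟨⟨0, by omega⟩⟩
    have : Nonempty (Set.powersetCard (Fin n) 2) :=
      ⟨⟨{⟨0, by omega⟩, ⟨1, by omega⟩}, Finset.card_pair (fun h => absurd (congrArg Fin.val h) Nat.zero_ne_one)⟩⟩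
    have : MulAction.IsPretransitive (Equiv.Perm (Fin n)) (Set.powersetCard (Fin n) 2) :=
      Set.powersetCard.isPretransitive
    have a := burnside_pretransitive (G := Equiv.Perm (Fin n)) (X := Fin n)
    have b := burnside_pretransitive (G := Equiv.Perm (Fin n)) (X := Set.powersetCard (Fin n) 2)
    simp only [rho1_eq, rho2_eq]
    exact_mod_cast b.trans a.symm
  have h2 : (rho2 (1 : Equiv.Perm (Fin n)) : ℤ) - (rho1 (1 : Equiv.Perm (Fin n)) : ℤ) =
        (n.choose 2 : ℤ) - (n : ℤ) := by
    have e2 : rho2 (1 : Equiv.Perm (Fin n)) = n.choose 2 := by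
      have : (Finset.univ.filter fun A : Finset (Fin n) => A.card = 2) =
          Finset.powersetCard 2 Finset.univ := by
        ext A; simp
      simp [rho2, this]
    simp [e2, rho1]
  have h3 : (rho2 (1 : Equiv.Perm (Fin n)) : ℤ) - (rho1 (1 : Equiv.Perm (Fin n)) : ℤ) ≠ 0 := by
    rw [h2]
    obtain ⟨m, rfl⟩ : ∃ m, n = m + 4 := ⟨n - 4, by omega⟩
    have hc := Nat.choose_two_right (m + 4)
    have hd : (m + 4) * (m + 4 - 1) = 2 * (m + 4) + ((m + 4) * (m + 1)) := by
      simp only [show m + 4 - 1 = m + 3 by omega]; ring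
    have : 4 ≤ (m + 4) * (m + 1) := by nlinarith
    omega
  refine ⟨h1, ⟨h2, h3⟩, ?_⟩
  rintro ⟨X, _, φ, hφ⟩
  have hs : ∑ σ : Equiv.Perm (Fin n), (Set.ncard {x : X | φ σ x = x} : ℤ) = 0 := by
    simp only [hφ, Finset.sum_sub_distrib, h1, sub_self]
  have hz := (Finset.sum_eq_zero_iff_of_nonneg (fun σ _ => by positivity)).1 hs 1 (Finset.mem_univ _)
  exact h3 ((hφ 1).symm.trans hz)
end
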